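/- arXiv:2202.03100 — 5 statements merged into one kernel-verified Lean document; each statement's English description precedes it below -/
import Mathlib

section
/- Let 𝒳, 𝒴, 𝒵, 𝓑 be finite sets, π_{XYZ} a distribution on 𝒳×𝒴×𝒵, and h_W, h_Ŵ ≥ 0 real numbers. Consider the quantity Δ defined as the minimum, over finite auxiliary alphabets 𝒰, 𝒰̂, 𝒱 and distributions P_{UÛV}, P_{B|XUÛV}, P_{Y|BUÛV}, P_{Z|BUV} satisfying H(U|V) ≤ h_W + H(BU|XYZV) and H(UÛ|V) ≤ h_Ŵ + h_W + H(BUÛ|XYZV), of D(P_{YZ|XV} ‖ π_{YZ|X} | π_X P_V), with entropies evaluated under π_X P_{UÛV} P_{B|XUÛV} P_{Y|BUÛV} P_{Z|BUV}. Then the value of Δ is unchanged if the minimization is further restricted to alphabets with |𝒱| ≤ 3, |𝒰| ≤ 3(|𝒳||𝒴||𝒵|+1), and |𝒰̂| ≤ 3(|𝒳||𝒴||𝒵|+1)·|𝓑||𝒳||𝒴||𝒵|. -/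
open scoped BigOperators ENNReal
open Classical

noncomputable section

/-- `p` is a probability mass function on the finite type `α`. -/
def IsDist {α : Type} [Fintype α] (p : α → ℝ) : Prop :=
  (∀ a, 0 ≤ p a) ∧ (∑ a, p a) = 1

/-- `k` is a conditional probability kernel. -/
def IsKernel {α β : Type} [Fintype β] (k : α → β → ℝ) : Prop :=
  ∀ a, (∀ b, 0 ≤ k a b) ∧ (∑ b, k a b) = 1

/-- Marginal (pushforward) of `p` along the map `f`. -/
def marg {α β : Type} [Fintype α] (f : α → β) (p : α → ℝ) : β → ℝ :=
  fun b => ∑ a, if f a = b then p a else 0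

/-- Shannon entropy (natural log). -/
def ent {α : Type} [Fintype α] (p : α → ℝ) : ℝ :=
  ∑ a, Real.negMulLog (p a)

/-- Conditional entropy `H(f(A) | g(A))` for `A ∼ p`. -/
def condEnt {α β γ : Type} [Fintype α] [Fintype β] [Fintype γ]
    (f : α → β) (g : α → γ) (p : α → ℝ) : ℝ :=
  ent (marg (fun a => (f a, g a)) p) - ent (marg g p)

/-- Kullback–Leibler divergence `D(p‖q)` with value `⊤` if `p` is not absolutely
continuous with respect to `q`. -/
def KL {α : Type} [Fintype α] (p q : α → ℝ) : ℝ≥0∞ :=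
  if ∀ a, q a = 0 → p a = 0 then ENNReal.ofReal (∑ a, p a * Real.log (p a / q a)) else ⊤


/-- Conditional mutual information `I(f(A); g(A) | h(A))` for `A ∼ p`. -/
def condMI {α β γ δ : Type} [Fintype α] [Fintype β] [Fintype γ] [Fintype δ]
    (f : α → β) (g : α → γ) (h : α → δ) (p : α → ℝ) : ℝ :=
  condEnt f h p + condEnt g h p - condEnt (fun a => (f a, g a)) h p

/-- The joint distribution `π_X P_{UÛV} P_{B|XUÛV} P_{Y|BUÛV} P_{Z|BUV}`
on `X × U × Û × V × B × Y × Z`. -/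
def bJoint {X Y Z B U Uh V : Type} (πX : X → ℝ) (PUUV : U × Uh × V → ℝ)
    (PB : X × U × Uh × V → B → ℝ) (PY : B × U × Uh × V → Y → ℝ)
    (PZ : B × U × V → Z → ℝ) : X × U × Uh × V × B × Y × Z → ℝ :=
  fun q => πX q.1 * PUUV (q.2.1, q.2.2.1, q.2.2.2.1) *
    PB (q.1, q.2.1, q.2.2.1, q.2.2.2.1) q.2.2.2.2.1 *
    PY (q.2.2.2.2.1, q.2.1, q.2.2.1, q.2.2.2.1) q.2.2.2.2.2.1 *
    PZ (q.2.2.2.2.1, q.2.1, q.2.2.2.1) q.2.2.2.2.2.2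

/-- Feasible values of `D(P_{YZ|XV} ‖ π_{YZ|X} | π_X P_V)` for the broadcast lower
bound `Δ(π_{XYZ}, P_W P_Ŵ)`: the constraints are `H(U|V) ≤ h_W + H(BU|XYZV)` and
`H(UÛ|V) ≤ h_Ŵ + h_W + H(BUÛ|XYZV)`.  If `extra = true`, the term
`I(B;Û|XYZUV)` is added to the left side of the first constraint (giving `Δ̂`). -/
def bDeltaSet (X Y Z B : Type) [Fintype X] [Fintype Y] [Fintype Z] [Fintype B]
    (π : X × Y × Z → ℝ) (hW hWh : ℝ) (extra : Bool) : Set ℝ≥0∞ :=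
  { d | ∃ (m mh l : ℕ) (PUUV : Fin m × Fin mh × Fin l → ℝ)
      (PB : X × Fin m × Fin mh × Fin l → B → ℝ)
      (PY : B × Fin m × Fin mh × Fin l → Y → ℝ)
      (PZ : B × Fin m × Fin l → Z → ℝ),
      IsDist PUUV ∧ IsKernel PB ∧ IsKernel PY ∧ IsKernel PZ ∧
      (condEnt (fun q : X × Fin m × Fin mh × Fin l × B × Y × Z => q.2.1)
          (fun q => q.2.2.2.1)
          (bJoint (marg (fun p : X × Y × Z => p.1) π) PUUV PB PY PZ) +
        (if extra then
          condMI (fun q : X × Fin m × Fin mh × Fin l × B × Y × Z => q.2.2.2.2.1)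
            (fun q => q.2.2.1)
            (fun q => (q.1, q.2.2.2.2.2.1, q.2.2.2.2.2.2, q.2.1, q.2.2.2.1))
            (bJoint (marg (fun p : X × Y × Z => p.1) π) PUUV PB PY PZ)
        else 0) ≤
        hW + condEnt (fun q : X × Fin m × Fin mh × Fin l × B × Y × Z =>
            (q.2.2.2.2.1, q.2.1))
          (fun q => (q.1, q.2.2.2.2.2.1, q.2.2.2.2.2.2, q.2.2.2.1))
          (bJoint (marg (fun p : X × Y × Z => p.1) π) PUUV PB PY PZ)) ∧
      condEnt (fun q : X × Fin m × Fin mh × Fin l × B × Y × Z => (q.2.1, q.2.2.1))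
          (fun q => q.2.2.2.1)
          (bJoint (marg (fun p : X × Y × Z => p.1) π) PUUV PB PY PZ) ≤
        hWh + hW +
          condEnt (fun q : X × Fin m × Fin mh × Fin l × B × Y × Z =>
              (q.2.2.2.2.1, q.2.1, q.2.2.1))
            (fun q => (q.1, q.2.2.2.2.2.1, q.2.2.2.2.2.2, q.2.2.2.1))
            (bJoint (marg (fun p : X × Y × Z => p.1) π) PUUV PB PY PZ) ∧
      d = KL
          (marg (fun q : X × Fin m × Fin mh × Fin l × B × Y × Z =>
              (q.1, q.2.2.2.1, q.2.2.2.2.2.1, q.2.2.2.2.2.2))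
            (bJoint (marg (fun p : X × Y × Z => p.1) π) PUUV PB PY PZ))
          (fun r : X × Fin l × Y × Z =>
            marg (fun p : Fin m × Fin mh × Fin l => p.2.2) PUUV r.2.1 *
              π (r.1, r.2.2.1, r.2.2.2)) }

/-- The same set as `bDeltaSet`, restricted to auxiliary alphabets with
`|𝒰| ≤ mBd`, `|𝒰̂| ≤ mhBd`, `|𝒱| ≤ lBd`. -/
def bDeltaSetBdd (X Y Z B : Type) [Fintype X] [Fintype Y] [Fintype Z] [Fintype B]
    (π : X × Y × Z → ℝ) (hW hWh : ℝ) (extra : Bool) (mBd mhBd lBd : ℕ) : Set ℝ≥0∞ :=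
  { d | ∃ (m mh l : ℕ), m ≤ mBd ∧ mh ≤ mhBd ∧ l ≤ lBd ∧
      ∃ (PUUV : Fin m × Fin mh × Fin l → ℝ)
      (PB : X × Fin m × Fin mh × Fin l → B → ℝ)
      (PY : B × Fin m × Fin mh × Fin l → Y → ℝ)
      (PZ : B × Fin m × Fin l → Z → ℝ),
      IsDist PUUV ∧ IsKernel PB ∧ IsKernel PY ∧ IsKernel PZ ∧
      (condEnt (fun q : X × Fin m × Fin mh × Fin l × B × Y × Z => q.2.1)
          (fun q => q.2.2.2.1)
          (bJoint (marg (fun p : X × Y × Z => p.1) π) PUUV PB PY PZ) +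
        (if extra then
          condMI (fun q : X × Fin m × Fin mh × Fin l × B × Y × Z => q.2.2.2.2.1)
            (fun q => q.2.2.1)
            (fun q => (q.1, q.2.2.2.2.2.1, q.2.2.2.2.2.2, q.2.1, q.2.2.2.1))
            (bJoint (marg (fun p : X × Y × Z => p.1) π) PUUV PB PY PZ)
        else 0) ≤
        hW + condEnt (fun q : X × Fin m × Fin mh × Fin l × B × Y × Z =>
            (q.2.2.2.2.1, q.2.1))
          (fun q => (q.1, q.2.2.2.2.2.1, q.2.2.2.2.2.2, q.2.2.2.1))
          (bJoint (marg (fun p : X × Y × Z => p.1) π) PUUV PB PY PZ)) ∧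
      condEnt (fun q : X × Fin m × Fin mh × Fin l × B × Y × Z => (q.2.1, q.2.2.1))
          (fun q => q.2.2.2.1)
          (bJoint (marg (fun p : X × Y × Z => p.1) π) PUUV PB PY PZ) ≤
        hWh + hW +
          condEnt (fun q : X × Fin m × Fin mh × Fin l × B × Y × Z =>
              (q.2.2.2.2.1, q.2.1, q.2.2.1))
            (fun q => (q.1, q.2.2.2.2.2.1, q.2.2.2.2.2.2, q.2.2.2.1))
            (bJoint (marg (fun p : X × Y × Z => p.1) π) PUUV PB PY PZ) ∧
      d = KL
          (marg (fun q : X × Fin m × Fin mh × Fin l × B × Y × Z =>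
              (q.1, q.2.2.2.1, q.2.2.2.2.2.1, q.2.2.2.2.2.2))
            (bJoint (marg (fun p : X × Y × Z => p.1) π) PUUV PB PY PZ))
          (fun r : X × Fin l × Y × Z =>
            marg (fun p : Fin m × Fin mh × Fin l => p.2.2) PUUV r.2.1 *
              π (r.1, r.2.2.1, r.2.2.2)) }

/-! ### Sparse reweighting -/

lemma exists_relation_of_card_lt {ι κ : Type} [Fintype ι] [Fintype κ] (F : ι → κ → ℝ)
    (g : ι → ℝ) (s : Finset ι) (hs : Fintype.card κ < s.card) :
    ∃ c : ι → ℝ, (∀ i, i ∉ s → c i = 0) ∧ (∃ i, c i ≠ 0) ∧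
      (∀ k, ∑ i, c i * F i k = 0) ∧ 0 ≤ ∑ i, c i * g i := by
  have hdep : ¬ LinearIndependent ℝ (fun i : s => F i) := by
    intro h
    have := h.fintype_card_le_finrank
    simp at this
    omega
  obtain ⟨c, hc, i₀, hi₀⟩ := Fintype.not_linearIndependent_iff.1 hdep
  let c' : ι → ℝ := fun i => if h : i ∈ s then c ⟨i, h⟩ else 0
  have hsum : ∀ f : ι → ℝ, ∑ i, c' i * f i = ∑ i : s, c i * f i := by
    intro f
    rw [← Finset.sum_subset (Finset.subset_univ s) (fun i _ hi => by simp [c', hi]),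
      ← Finset.sum_coe_sort]
    exact Finset.sum_congr rfl fun i _ => by simp [c']
  have hoff : ∀ i, i ∉ s → c' i = 0 := fun i hi => by simp [c', hi]
  have hne : c' i₀ ≠ 0 := by simpa [c'] using hi₀
  have hF : ∀ k, ∑ i, c' i * F i k = 0 := by
    intro k
    rw [hsum fun i => F i k]
    simpa using congrFun hc k
  rcases le_total 0 (∑ i, c' i * g i) with h | h
  · exact ⟨c', hoff, ⟨i₀, hne⟩, hF, h⟩
  · refine ⟨fun i => -c' i, fun i hi => by simp [hoff i hi], ⟨i₀, by simpa using hne⟩, ?_, ?_⟩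
    · intro k
      simp [hF k]
    · simpa using h

/-- Basic solutions of a linear program: nonnegative weights can be replaced by weights with
support at most the number of equality constraints, without decreasing the objective `g`. -/
lemma exists_sparse_weights {ι κ : Type} [Fintype ι] [Fintype κ] (F : ι → κ → ℝ) (r : κ → ℝ)
    (hr : ∀ i, ∑ k, r k * F i k = 1) (g w : ι → ℝ) (hw : ∀ i, 0 ≤ w i) :
    ∃ w' : ι → ℝ, (∀ i, 0 ≤ w' i) ∧ (∀ i, w i = 0 → w' i = 0) ∧
      (∀ k, ∑ i, w' i * F i k = ∑ i, w i * F i k) ∧ ∑ i, w i * g i ≤ ∑ i, w' i * g i ∧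
      (Finset.univ.filter fun i => w' i ≠ 0).card ≤ Fintype.card κ := by
  induction hn : (Finset.univ.filter fun i => w i ≠ 0).card using Nat.strong_induction_on
    generalizing w with
  | _ n ih =>
    by_cases hcard : n ≤ Fintype.card κ
    · exact ⟨w, hw, fun _ h => h, fun _ => rfl, le_rfl, hn ▸ hcard⟩
    obtain ⟨c, hoff, ⟨i₁, hi₁⟩, hF, hg⟩ :=
      exists_relation_of_card_lt F g (Finset.univ.filter fun i => w i ≠ 0) (by omega)
    have hzero : ∀ i, w i = 0 → c i = 0 := fun i hi => hoff i (by simp [hi])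
    have hsum : ∑ i, c i = 0 := by
      calc ∑ i, c i = ∑ i, c i * ∑ k, r k * F i k := by simp [hr]
        _ = ∑ k, r k * ∑ i, c i * F i k := by
          simp only [Finset.mul_sum]
          rw [Finset.sum_comm]
          exact Finset.sum_congr rfl fun _ _ => Finset.sum_congr rfl fun _ _ => by ring
        _ = 0 := by simp [hF]
    have hneg : (Finset.univ.filter fun i => c i < 0).Nonempty := by
      by_contra! h
      have hpos : ∀ i ∈ Finset.univ, 0 ≤ c i := by
        intro i _
        by_contra! hi
        have : i ∈ Finset.univ.filter fun i => c i < 0 := by simpa using hi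
        simp [h] at this
      exact hi₁ ((Finset.sum_eq_zero_iff_of_nonneg hpos).1 hsum i₁ (Finset.mem_univ _))
    obtain ⟨i₀, hi₀, hmin⟩ := Finset.exists_min_image _ (fun i => w i / (-c i)) hneg
    have hc₀ : c i₀ < 0 := by simpa using hi₀
    set t := w i₀ / (-c i₀) with ht
    have ht0 : 0 ≤ t := div_nonneg (hw _) (by linarith)
    have hnn : ∀ i, 0 ≤ w i + t * c i := by
      intro i
      rcases lt_or_ge (c i) 0 with h | h
      · have := hmin i (by simpa using h)
        rw [le_div_iff₀ (by linarith)] at this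
        linarith
      · exact add_nonneg (hw i) (mul_nonneg ht0 h)
    have hi₀' : w i₀ + t * c i₀ = 0 := by
      have : t * (-c i₀) = w i₀ := div_mul_cancel₀ _ (by linarith)
      linarith
    have hlt : (Finset.univ.filter fun i => w i + t * c i ≠ 0).card < n := by
      rw [← hn]
      refine Finset.card_lt_card (Finset.ssubset_iff_of_subset ?_ |>.2 ⟨i₀, ?_, ?_⟩)
      · intro i
        simp only [Finset.mem_filter, Finset.mem_univ, true_and]
        intro h h0
        simp [h0, hzero i h0] at h
      · simp only [Finset.mem_filter, Finset.mem_univ, true_and]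
        intro h0
        exact hc₀.ne (hzero _ h0)
      · simp [hi₀']
    obtain ⟨w', h1, h2, h3, h4, h5⟩ := ih _ hlt (fun i => w i + t * c i) hnn rfl
    have hlin : ∀ f : ι → ℝ,
        ∑ i, (w i + t * c i) * f i = ∑ i, w i * f i + t * ∑ i, c i * f i := by
      intro f
      rw [Finset.mul_sum, ← Finset.sum_add_distrib]
      exact Finset.sum_congr rfl fun _ _ => by ring
    refine ⟨w', h1, fun i hi => h2 i (by simp [hi, hzero i hi]), fun k => ?_, ?_, h5⟩
    · rw [h3 k, hlin, hF k]
      simp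
    · rw [hlin] at h4
      nlinarith [mul_nonneg ht0 hg]

/-- The sparse weights of `exists_sparse_weights`, indexed by `Fin N`. -/
lemma exists_fin_weights {ι κ : Type} [Fintype ι] [Nonempty ι] [Fintype κ] (F : ι → κ → ℝ)
    (r : κ → ℝ) (hr : ∀ i, ∑ k, r k * F i k = 1) (g w : ι → ℝ) (hw : ∀ i, 0 ≤ w i)
    (N : ℕ) (hN : Fintype.card κ = N) :
    ∃ (e : Fin N → ι) (w' : Fin N → ℝ), (∀ j, 0 ≤ w' j) ∧ (∀ j, w' j ≠ 0 → w (e j) ≠ 0) ∧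
      (∀ k, ∑ j, w' j * F (e j) k = ∑ i, w i * F i k) ∧
      ∑ j, w' j = ∑ i, w i ∧ ∑ i, w i * g i ≤ ∑ j, w' j * g (e j) := by
  obtain ⟨v, h1, h2, h3, h4, h5⟩ := exists_sparse_weights F r hr g w hw
  let s : Finset ι := Finset.univ.filter fun i => v i ≠ 0
  obtain ⟨f⟩ : Nonempty (s ↪ Fin N) :=
    Function.Embedding.nonempty_of_card_le (by
      rw [Fintype.card_coe, Fintype.card_fin, ← hN]
      exact h5)
  let e : Fin N → ι := Function.extend f (fun i : s => (i : ι)) fun _ => Classical.arbitrary ι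
  let w' : Fin N → ℝ := Function.extend f (fun i : s => v i) 0
  have he : ∀ i, e (f i) = i := fun i => f.injective.extend_apply _ _ i
  have hw' : ∀ i, w' (f i) = v i := fun i => f.injective.extend_apply _ _ i
  have hw0 : ∀ j, j ∉ Set.range f → w' j = 0 := fun j hj =>
    Function.extend_apply' _ _ _ (by simpa using hj)
  have hsum : ∀ φ : ι → ℝ, ∑ j, w' j * φ (e j) = ∑ i, v i * φ i := by
    intro φ
    rw [← Finset.sum_subset (Finset.subset_univ s)
        (fun i _ hi => by
          have : v i = 0 := by simpa [s] using hi
          simp [this]),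
      ← Finset.sum_coe_sort s]
    symm
    refine Finset.sum_of_injOn (f := fun i : s => v i * φ i) (g := fun j => w' j * φ (e j)) f
      f.injective.injOn (fun _ _ => Finset.mem_coe.2 (Finset.mem_univ _)) ?_ ?_
    · intro j _ hj
      rw [hw0 j (by simpa using hj), zero_mul]
    · intro i _
      rw [he, hw']
  have htot : ∀ u : ι → ℝ, ∑ i, u i = ∑ k, r k * ∑ i, u i * F i k := by
    intro u
    calc ∑ i, u i = ∑ i, u i * ∑ k, r k * F i k := by simp [hr]
      _ = _ := by
        simp only [Finset.mul_sum]
        rw [Finset.sum_comm]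
        exact Finset.sum_congr rfl fun _ _ => Finset.sum_congr rfl fun _ _ => by ring
  refine ⟨e, w', ?_, ?_, ?_, ?_, ?_⟩
  · intro j
    by_cases hj : j ∈ Set.range f
    · obtain ⟨i, rfl⟩ := hj
      rw [hw']
      exact h1 _
    · rw [hw0 j hj]
  · intro j hj
    by_cases hj' : j ∈ Set.range f
    · obtain ⟨i, rfl⟩ := hj'
      rw [hw'] at hj
      rw [he]
      exact fun h => hj (h2 _ h)
    · exact absurd (hw0 j hj') hj
  · intro k
    rw [hsum fun i => F i k, h3 k]
  · have := hsum fun _ => 1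
    simp only [mul_one] at this
    rw [this, htot v, htot w]
    simp only [h3]
  · rwa [hsum]

/-! ### Kernels, marginals and entropies -/

lemma IsDist.nonempty {α : Type} [Fintype α] {p : α → ℝ} (hp : IsDist p) : Nonempty α := by
  by_contra h
  rw [not_nonempty_iff] at h
  simpa using hp.2

/-- Disintegration of a nonnegative function along its first coordinate. -/
lemma exists_kernel {α β : Type} [Fintype β] [Nonempty β] (p : α → β → ℝ)
    (hp : ∀ a b, 0 ≤ p a b) :
    ∃ k : α → β → ℝ, IsKernel k ∧ ∀ a b, p a b = (∑ b', p a b') * k a b := by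
  refine ⟨fun a b => if ∑ b', p a b' = 0 then (Pi.single (Classical.arbitrary β) 1 : β → ℝ) b
    else p a b / ∑ b', p a b', fun a => ?_, fun a b => ?_⟩
  · by_cases h : ∑ b', p a b' = 0
    · simp only [h, if_true]
      exact ⟨fun b => (Pi.single_nonneg.2 zero_le_one : (0 : β → ℝ) ≤ _) b, by simp⟩
    · simp only [h, if_false]
      exact ⟨fun b => div_nonneg (hp a b) (Finset.sum_nonneg fun _ _ => hp a _),
        by rw [← Finset.sum_div, div_self h]⟩
  · by_cases h : ∑ b', p a b' = 0
    · simp only [h, zero_mul]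
      exact (Finset.sum_eq_zero_iff_of_nonneg fun b _ => hp a b).1 h b (Finset.mem_univ _)
    · simp only [h, if_false]
      field_simp

lemma marg_apply_of_equiv {α β γ δ : Type} [Fintype α] [Fintype γ] [Fintype δ]
    {f : α → β} (p : α → ℝ) (e : δ × γ ≃ α) (σ : δ → β) (hσ : Function.Injective σ)
    (h : ∀ d c, f (e (d, c)) = σ d) (d : δ) :
    marg f p (σ d) = ∑ c, p (e (d, c)) := by
  unfold marg
  rw [← e.sum_comp, Fintype.sum_prod_type, Finset.sum_eq_single d]
  · simp [h]
  · intro d' _ hd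
    simp [h, hσ.ne hd]
  · simp

lemma ent_marg_of_equiv {α β γ δ : Type} [Fintype α] [Fintype β] [Fintype γ] [Fintype δ]
    {f : α → β} (p : α → ℝ) (e : δ × γ ≃ α) (σ : δ ≃ β)
    (h : ∀ d c, f (e (d, c)) = σ d) {q : δ → ℝ} (hq : ∀ d, ∑ c, p (e (d, c)) = q d) :
    ent (marg f p) = ent q := by
  unfold ent
  rw [← σ.sum_comp]
  exact Finset.sum_congr rfl fun d _ => by
    rw [marg_apply_of_equiv p e σ σ.injective h, hq]

/-- Chain rule for entropy. -/
lemma ent_mul {α β : Type} [Fintype α] [Fintype β] (p : α → ℝ) {k : α → β → ℝ}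
    (hk : ∀ a, ∑ b, k a b = 1) :
    ent (fun x : α × β => p x.1 * k x.1 x.2) = ent p + ∑ a, p a * ent (k a) := by
  simp only [ent, Fintype.sum_prod_type, Real.negMulLog_mul, Finset.sum_add_distrib,
    ← Finset.sum_mul, ← Finset.mul_sum, hk, one_mul]

/-! ### The broadcast quantities after conditioning on the auxiliary variables -/

/-- The law of `(X, B, Y, Z)` given `(V, U, Û)`. -/
def bCond {X Y Z B U Uh V : Type} (πX : X → ℝ)
    (PB : X × U × Uh × V → B → ℝ) (PY : B × U × Uh × V → Y → ℝ)
    (PZ : B × U × V → Z → ℝ) (v : V) (u : U) (uh : Uh) : X × B × Y × Z → ℝ :=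
  fun t => πX t.1 * PB (t.1, u, uh, v) t.2.1 * PY (t.2.1, u, uh, v) t.2.2.1 *
    PZ (t.2.1, u, v) t.2.2.2

lemma bCond_isDist {X Y Z B U Uh V : Type} [Fintype X] [Fintype Y] [Fintype Z] [Fintype B]
    {πX : X → ℝ} {PB : X × U × Uh × V → B → ℝ} {PY : B × U × Uh × V → Y → ℝ}
    {PZ : B × U × V → Z → ℝ} (hX : IsDist πX) (hB : IsKernel PB) (hY : IsKernel PY)
    (hZ : IsKernel PZ) (v : V) (u : U) (uh : Uh) : IsDist (bCond πX PB PY PZ v u uh) := by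
  constructor
  · intro t
    exact mul_nonneg (mul_nonneg (mul_nonneg (hX.1 _) ((hB _).1 _)) ((hY _).1 _)) ((hZ _).1 _)
  · simp only [bCond, Fintype.sum_prod_type, ← Finset.mul_sum, (hZ _).2, (hY _).2, (hB _).2,
      mul_one, hX.2]

/-- The mixture of the functions `Q w` with weights `c w`. -/
def mix {T W : Type} [Fintype W] (c : W → ℝ) (Q : W → T → ℝ) : T → ℝ :=
  fun t => ∑ w, c w * Q w t

lemma mix_sum {T W : Type} [Fintype T] [Fintype W] {c : W → ℝ} {Q : W → T → ℝ}
    (hc : ∑ w, c w = 1) (hQ : ∀ w, ∑ t, Q w t = 1) : ∑ t, mix c Q t = 1 := by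
  unfold mix
  rw [Finset.sum_comm]
  simp [← Finset.mul_sum, hQ, hc]

/-- The marginal on `(X, Y, Z)` of a function of `(X, B, Y, Z)`. -/
def dropB {X Y Z B : Type} [Fintype B] (q : X × B × Y × Z → ℝ) : X × Y × Z → ℝ :=
  fun t => ∑ b, q (t.1, b, t.2.1, t.2.2)

lemma dropB_sum {X Y Z B : Type} [Fintype X] [Fintype Y] [Fintype Z] [Fintype B]
    {q : X × B × Y × Z → ℝ} (hq : ∑ t, q t = 1) : ∑ t, dropB q t = 1 := by
  let e : (X × Y × Z) × B ≃ X × B × Y × Z :=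
    { toFun := fun ⟨⟨x, y, z⟩, b⟩ => (x, b, y, z)
      invFun := fun ⟨x, b, y, z⟩ => ((x, y, z), b)
      left_inv := fun _ => rfl
      right_inv := fun _ => rfl }
  rw [← hq, ← e.sum_comp, Fintype.sum_prod_type (α₁ := X × Y × Z)]
  rfl

section Factored

variable {X Y Z B U Uh V : Type}

/-- The joint function of `(X, U, Û, V, B, Y, Z)` with conditional law `Q` of `(X, B, Y, Z)`. -/
def factored (a : V → ℝ) (b : V → U → ℝ) (c : V → U → Uh → ℝ)
    (Q : V → U → Uh → X × B × Y × Z → ℝ) : X × U × Uh × V × B × Y × Z → ℝ :=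
  fun ⟨x, u, uh, v, b', y, z⟩ => a v * b v u * c v u uh * Q v u uh (x, b', y, z)

lemma bJoint_eq_factored {πX : X → ℝ} {PUUV : U × Uh × V → ℝ}
    {PB : X × U × Uh × V → B → ℝ} {PY : B × U × Uh × V → Y → ℝ} {PZ : B × U × V → Z → ℝ}
    {a : V → ℝ} {b : V → U → ℝ} {c : V → U → Uh → ℝ}
    (h : ∀ u uh v, PUUV (u, uh, v) = a v * b v u * c v u uh) :
    bJoint πX PUUV PB PY PZ = factored a b c (bCond πX PB PY PZ) := by
  funext ⟨x, u, uh, v, b', y, z⟩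
  simp only [bJoint, factored, bCond, h]
  ring

variable [Fintype X] [Fintype Y] [Fintype Z] [Fintype B] [Fintype U] [Fintype Uh] [Fintype V]
  {a : V → ℝ} {b : V → U → ℝ} {c : V → U → Uh → ℝ}
  {Q : V → U → Uh → X × B × Y × Z → ℝ}

lemma ent_marg_V (hb : ∀ v, ∑ u, b v u = 1) (hc : ∀ v u, ∑ uh, c v u uh = 1)
    (hQ : ∀ v u uh, ∑ t, Q v u uh t = 1) :
    ent (marg (fun q : X × U × Uh × V × B × Y × Z => q.2.2.2.1) (factored a b c Q)) = ent a := by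
  let e : V × (U × Uh × X × B × Y × Z) ≃ X × U × Uh × V × B × Y × Z :=
    { toFun := fun ⟨v, u, uh, x, b', y, z⟩ => (x, u, uh, v, b', y, z)
      invFun := fun ⟨x, u, uh, v, b', y, z⟩ => (v, u, uh, x, b', y, z)
      left_inv := fun _ => rfl
      right_inv := fun _ => rfl }
  refine ent_marg_of_equiv _ e (Equiv.refl V) (fun _ _ => rfl) fun v => ?_
  rw [Fintype.sum_prod_type]
  simp_rw [Fintype.sum_prod_type (α₁ := Uh)]
  change ∑ u, ∑ uh, ∑ t, a v * b v u * c v u uh * Q v u uh t = _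
  simp only [← Finset.mul_sum, hb, hc, hQ, mul_one]

lemma ent_marg_UV (hb : ∀ v, ∑ u, b v u = 1) (hc : ∀ v u, ∑ uh, c v u uh = 1)
    (hQ : ∀ v u uh, ∑ t, Q v u uh t = 1) :
    ent (marg (fun q : X × U × Uh × V × B × Y × Z => (q.2.1, q.2.2.2.1)) (factored a b c Q)) =
      ent a + ∑ v, a v * ent (b v) := by
  let e : (V × U) × (Uh × X × B × Y × Z) ≃ X × U × Uh × V × B × Y × Z :=
    { toFun := fun ⟨⟨v, u⟩, uh, x, b', y, z⟩ => (x, u, uh, v, b', y, z)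
      invFun := fun ⟨x, u, uh, v, b', y, z⟩ => ((v, u), uh, x, b', y, z)
      left_inv := fun _ => rfl
      right_inv := fun _ => rfl }
  rw [← ent_mul a hb]
  refine ent_marg_of_equiv _ e (Equiv.prodComm V U) (fun _ _ => rfl) fun ⟨v, u⟩ => ?_
  rw [Fintype.sum_prod_type]
  change ∑ uh, ∑ t, a v * b v u * c v u uh * Q v u uh t = _
  simp only [← Finset.mul_sum, hc, hQ, mul_one]

lemma ent_marg_UUhV (hb : ∀ v, ∑ u, b v u = 1) (hc : ∀ v u, ∑ uh, c v u uh = 1)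
    (hQ : ∀ v u uh, ∑ t, Q v u uh t = 1) :
    ent (marg (fun q : X × U × Uh × V × B × Y × Z => ((q.2.1, q.2.2.1), q.2.2.2.1))
        (factored a b c Q)) =
      ent a + ∑ v, a v * ent (b v) + ∑ v, ∑ u, a v * b v u * ent (c v u) := by
  let e : ((V × U) × Uh) × (X × B × Y × Z) ≃ X × U × Uh × V × B × Y × Z :=
    { toFun := fun ⟨⟨⟨v, u⟩, uh⟩, x, b', y, z⟩ => (x, u, uh, v, b', y, z)
      invFun := fun ⟨x, u, uh, v, b', y, z⟩ => (((v, u), uh), x, b', y, z)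
      left_inv := fun _ => rfl
      right_inv := fun _ => rfl }
  let σ : (V × U) × Uh ≃ (U × Uh) × V :=
    { toFun := fun ⟨⟨v, u⟩, uh⟩ => ((u, uh), v)
      invFun := fun ⟨⟨u, uh⟩, v⟩ => ((v, u), uh)
      left_inv := fun _ => rfl
      right_inv := fun _ => rfl }
  rw [← ent_mul a hb]
  refine (ent_marg_of_equiv _ e σ (fun _ _ => rfl)
    (q := fun y : (V × U) × Uh => (a y.1.1 * b y.1.1 y.1.2) * c y.1.1 y.1.2 y.2) ?_).trans ?_
  · rintro ⟨⟨v, u⟩, uh⟩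
    change ∑ t, a v * b v u * c v u uh * Q v u uh t = _
    simp only [← Finset.mul_sum, hQ, mul_one]
  · rw [ent_mul (fun y : V × U => a y.1 * b y.1 y.2) (k := fun y => c y.1 y.2)
      fun y => hc y.1 y.2, Fintype.sum_prod_type]

lemma ent_marg_BUXYZV (hb : ∀ v, ∑ u, b v u = 1) (hc : ∀ v u, ∑ uh, c v u uh = 1)
    (hQ : ∀ v u uh, ∑ t, Q v u uh t = 1) :
    ent (marg (fun q : X × U × Uh × V × B × Y × Z => ((q.2.2.2.2.1, q.2.1),
        (q.1, q.2.2.2.2.2.1, q.2.2.2.2.2.2, q.2.2.2.1))) (factored a b c Q)) =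
      ent a + ∑ v, a v * ent (b v) + ∑ v, ∑ u, a v * b v u * ent (mix (c v u) (Q v u)) := by
  let e : ((V × U) × (X × B × Y × Z)) × Uh ≃ X × U × Uh × V × B × Y × Z :=
    { toFun := fun ⟨⟨⟨v, u⟩, x, b', y, z⟩, uh⟩ => (x, u, uh, v, b', y, z)
      invFun := fun ⟨x, u, uh, v, b', y, z⟩ => (((v, u), x, b', y, z), uh)
      left_inv := fun _ => rfl
      right_inv := fun _ => rfl }
  let σ : (V × U) × (X × B × Y × Z) ≃ (B × U) × X × Y × Z × V :=
    { toFun := fun ⟨⟨v, u⟩, x, b', y, z⟩ => ((b', u), x, y, z, v)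
      invFun := fun ⟨⟨b', u⟩, x, y, z, v⟩ => ((v, u), x, b', y, z)
      left_inv := fun _ => rfl
      right_inv := fun _ => rfl }
  rw [← ent_mul a hb]
  refine (ent_marg_of_equiv _ e σ (fun _ _ => rfl)
    (q := fun y : (V × U) × (X × B × Y × Z) =>
      (a y.1.1 * b y.1.1 y.1.2) * mix (c y.1.1 y.1.2) (Q y.1.1 y.1.2) y.2) ?_).trans ?_
  · rintro ⟨⟨v, u⟩, t⟩
    change ∑ uh, a v * b v u * c v u uh * Q v u uh t = _
    simp only [mix, Finset.mul_sum, mul_assoc]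
  · rw [ent_mul (fun y : V × U => a y.1 * b y.1 y.2)
      (k := fun y => mix (c y.1 y.2) (Q y.1 y.2))
      fun y => mix_sum (hc _ _) (hQ _ _), Fintype.sum_prod_type]

lemma ent_marg_BUUhXYZV (hb : ∀ v, ∑ u, b v u = 1) (hc : ∀ v u, ∑ uh, c v u uh = 1)
    (hQ : ∀ v u uh, ∑ t, Q v u uh t = 1) :
    ent (marg (fun q : X × U × Uh × V × B × Y × Z => ((q.2.2.2.2.1, q.2.1, q.2.2.1),
        (q.1, q.2.2.2.2.2.1, q.2.2.2.2.2.2, q.2.2.2.1))) (factored a b c Q)) =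
      ent a + ∑ v, a v * ent (b v) + ∑ v, ∑ u, a v * b v u * ent (c v u) +
        ∑ v, ∑ u, ∑ uh, a v * b v u * c v u uh * ent (Q v u uh) := by
  let e : ((((V × U) × Uh) × (X × B × Y × Z)) × Unit) ≃ X × U × Uh × V × B × Y × Z :=
    { toFun := fun ⟨⟨⟨⟨v, u⟩, uh⟩, x, b', y, z⟩, _⟩ => (x, u, uh, v, b', y, z)
      invFun := fun ⟨x, u, uh, v, b', y, z⟩ => ((((v, u), uh), x, b', y, z), ())
      left_inv := fun _ => rfl
      right_inv := fun _ => rfl }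
  let σ : ((V × U) × Uh) × (X × B × Y × Z) ≃ (B × U × Uh) × X × Y × Z × V :=
    { toFun := fun ⟨⟨⟨v, u⟩, uh⟩, x, b', y, z⟩ => ((b', u, uh), x, y, z, v)
      invFun := fun ⟨⟨b', u, uh⟩, x, y, z, v⟩ => (((v, u), uh), x, b', y, z)
      left_inv := fun _ => rfl
      right_inv := fun _ => rfl }
  refine (ent_marg_of_equiv _ e σ (fun _ _ => rfl)
    (q := fun y : ((V × U) × Uh) × (X × B × Y × Z) =>
      ((a y.1.1.1 * b y.1.1.1 y.1.1.2) * c y.1.1.1 y.1.1.2 y.1.2) *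
        Q y.1.1.1 y.1.1.2 y.1.2 y.2) ?_).trans ?_
  · rintro ⟨⟨⟨v, u⟩, uh⟩, t⟩
    rw [Fintype.sum_unique]
    rfl
  · rw [ent_mul (fun y : (V × U) × Uh => (a y.1.1 * b y.1.1 y.1.2) * c y.1.1 y.1.2 y.2)
      (k := fun y => Q y.1.1 y.1.2 y.2) fun y => hQ _ _ _,
      ent_mul (fun y : V × U => a y.1 * b y.1 y.2) (k := fun y => c y.1 y.2)
      fun y => hc y.1 y.2, ent_mul a hb]
    simp only [Fintype.sum_prod_type (α₁ := V), Fintype.sum_prod_type (α₂ := Uh)]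

lemma ent_marg_XYZV (hb : ∀ v, ∑ u, b v u = 1) (hc : ∀ v u, ∑ uh, c v u uh = 1)
    (hQ : ∀ v u uh, ∑ t, Q v u uh t = 1) :
    ent (marg (fun q : X × U × Uh × V × B × Y × Z =>
        (q.1, q.2.2.2.2.2.1, q.2.2.2.2.2.2, q.2.2.2.1)) (factored a b c Q)) =
      ent a + ∑ v, a v * ent (mix (b v) fun u => dropB (mix (c v u) (Q v u))) := by
  let e : (V × X × Y × Z) × U × B × Uh ≃ X × U × Uh × V × B × Y × Z :=
    { toFun := fun ⟨⟨v, x, y, z⟩, u, b', uh⟩ => (x, u, uh, v, b', y, z)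
      invFun := fun ⟨x, u, uh, v, b', y, z⟩ => ((v, x, y, z), u, b', uh)
      left_inv := fun _ => rfl
      right_inv := fun _ => rfl }
  let σ : V × X × Y × Z ≃ X × Y × Z × V :=
    { toFun := fun ⟨v, x, y, z⟩ => (x, y, z, v)
      invFun := fun ⟨x, y, z, v⟩ => (v, x, y, z)
      left_inv := fun _ => rfl
      right_inv := fun _ => rfl }
  rw [← ent_mul a (k := fun v => mix (b v) fun u => dropB (mix (c v u) (Q v u)))
    fun v => mix_sum (hb v) fun u => dropB_sum (mix_sum (hc v u) (hQ v u))]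
  refine ent_marg_of_equiv _ e σ (fun _ _ => rfl) ?_
  rintro ⟨v, x, y, z⟩
  simp only [Fintype.sum_prod_type, mix, dropB, Finset.mul_sum]
  exact Finset.sum_congr rfl fun u _ => Finset.sum_congr rfl fun b' _ =>
    Finset.sum_congr rfl fun uh _ => by simp only [e, Equiv.coe_fn_mk, factored]; ring

lemma marg_XVYZ :
    marg (fun q : X × U × Uh × V × B × Y × Z =>
        (q.1, q.2.2.2.1, q.2.2.2.2.2.1, q.2.2.2.2.2.2)) (factored a b c Q) =
      fun r => a r.2.1 * mix (b r.2.1) (fun u => dropB (mix (c r.2.1 u) (Q r.2.1 u)))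
        (r.1, r.2.2) := by
  let e : (X × V × Y × Z) × U × B × Uh ≃ X × U × Uh × V × B × Y × Z :=
    { toFun := fun ⟨⟨x, v, y, z⟩, u, b', uh⟩ => (x, u, uh, v, b', y, z)
      invFun := fun ⟨x, u, uh, v, b', y, z⟩ => ((x, v, y, z), u, b', uh)
      left_inv := fun _ => rfl
      right_inv := fun _ => rfl }
  funext ⟨x, v, y, z⟩
  refine (marg_apply_of_equiv _ e id Function.injective_id (fun _ _ => rfl) (x, v, y, z)).trans ?_
  simp only [Fintype.sum_prod_type, mix, dropB, Finset.mul_sum]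
  exact Finset.sum_congr rfl fun u _ => Finset.sum_congr rfl fun b' _ =>
    Finset.sum_congr rfl fun uh _ => by simp only [e, Equiv.coe_fn_mk, factored]; ring

/-- `H(U|V) ≤ h + H(BU|XYZV)` says that the average over `V` of
`H(BXYZ|U,V=v) - H(XYZ|V=v)` is at least `-h`. -/
lemma constraint_U_iff (hb : ∀ v, ∑ u, b v u = 1) (hc : ∀ v u, ∑ uh, c v u uh = 1)
    (hQ : ∀ v u uh, ∑ t, Q v u uh t = 1) (h : ℝ) :
    condEnt (fun q : X × U × Uh × V × B × Y × Z => q.2.1) (fun q => q.2.2.2.1)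
        (factored a b c Q) ≤
      h + condEnt (fun q : X × U × Uh × V × B × Y × Z => (q.2.2.2.2.1, q.2.1))
        (fun q => (q.1, q.2.2.2.2.2.1, q.2.2.2.2.2.2, q.2.2.2.1)) (factored a b c Q) ↔
    -h ≤ ∑ v, a v * (∑ u, b v u * ent (mix (c v u) (Q v u)) -
      ent (mix (b v) fun u => dropB (mix (c v u) (Q v u)))) := by
  simp only [condEnt, ent_marg_V hb hc hQ, ent_marg_UV hb hc hQ, ent_marg_BUXYZV hb hc hQ,
    ent_marg_XYZV hb hc hQ, mul_sub, Finset.sum_sub_distrib, Finset.mul_sum, mul_assoc]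
  constructor <;> intro _ <;> linarith

/-- `H(UÛ|V) ≤ h + H(BUÛ|XYZV)` says that the average over `V` of
`H(BXYZ|UÛ,V=v) - H(XYZ|V=v)` is at least `-h`. -/
lemma constraint_UUh_iff (hb : ∀ v, ∑ u, b v u = 1) (hc : ∀ v u, ∑ uh, c v u uh = 1)
    (hQ : ∀ v u uh, ∑ t, Q v u uh t = 1) (h : ℝ) :
    condEnt (fun q : X × U × Uh × V × B × Y × Z => (q.2.1, q.2.2.1)) (fun q => q.2.2.2.1)
        (factored a b c Q) ≤
      h + condEnt (fun q : X × U × Uh × V × B × Y × Z => (q.2.2.2.2.1, q.2.1, q.2.2.1))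
        (fun q => (q.1, q.2.2.2.2.2.1, q.2.2.2.2.2.2, q.2.2.2.1)) (factored a b c Q) ↔
    -h ≤ ∑ v, a v * (∑ u, b v u * ∑ uh, c v u uh * ent (Q v u uh) -
      ent (mix (b v) fun u => dropB (mix (c v u) (Q v u)))) := by
  simp only [condEnt, ent_marg_V hb hc hQ, ent_marg_UUhV hb hc hQ, ent_marg_BUUhXYZV hb hc hQ,
    ent_marg_XYZV hb hc hQ, mul_sub, Finset.sum_sub_distrib, Finset.mul_sum, mul_assoc]
  constructor <;> intro _ <;> linarith

lemma marg_V_eq {PUUV : U × Uh × V → ℝ} (hb : ∀ v, ∑ u, b v u = 1)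
    (hc : ∀ v u, ∑ uh, c v u uh = 1)
    (h : ∀ u uh v, PUUV (u, uh, v) = a v * b v u * c v u uh) :
    marg (fun p : U × Uh × V => p.2.2) PUUV = a := by
  let e : V × U × Uh ≃ U × Uh × V :=
    { toFun := fun ⟨v, u, uh⟩ => (u, uh, v)
      invFun := fun ⟨u, uh, v⟩ => (v, u, uh)
      left_inv := fun _ => rfl
      right_inv := fun _ => rfl }
  funext v
  refine (marg_apply_of_equiv _ e id Function.injective_id (fun _ _ => rfl) v).trans ?_
  rw [Fintype.sum_prod_type]
  change ∑ u, ∑ uh, PUUV (u, uh, v) = a v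
  simp only [h, ← Finset.mul_sum, hb, hc, mul_one]

lemma isDist_factored (ha : IsDist a) (hb : IsKernel b) (hc : ∀ v, IsKernel (c v)) :
    IsDist fun p : U × Uh × V => a p.2.2 * b p.2.2 p.1 * c p.2.2 p.1 p.2.1 := by
  let e : V × U × Uh ≃ U × Uh × V :=
    { toFun := fun ⟨v, u, uh⟩ => (u, uh, v)
      invFun := fun ⟨u, uh, v⟩ => (v, u, uh)
      left_inv := fun _ => rfl
      right_inv := fun _ => rfl }
  refine ⟨fun p => mul_nonneg (mul_nonneg (ha.1 _) ((hb _).1 _)) ((hc _ _).1 _), ?_⟩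
  rw [← e.sum_comp, Fintype.sum_prod_type]
  simp_rw [Fintype.sum_prod_type (α₁ := U)]
  change ∑ v, ∑ u, ∑ uh, a v * b v u * c v u uh = 1
  simp only [← Finset.mul_sum, (hb _).2, (hc _ _).2, mul_one, ha.2]

lemma exists_factorization [Nonempty U] [Nonempty Uh] {PUUV : U × Uh × V → ℝ}
    (hP : IsDist PUUV) :
    ∃ (a : V → ℝ) (b : V → U → ℝ) (c : V → U → Uh → ℝ), IsDist a ∧ IsKernel b ∧
      (∀ v, IsKernel (c v)) ∧ ∀ u uh v, PUUV (u, uh, v) = a v * b v u * c v u uh := by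
  obtain ⟨c, hc, hc'⟩ := exists_kernel (fun (p : V × U) uh => PUUV (p.2, uh, p.1))
    fun _ _ => hP.1 _
  obtain ⟨b, hb, hb'⟩ := exists_kernel (fun v u => ∑ uh, PUUV (u, uh, v))
    fun _ _ => Finset.sum_nonneg fun _ _ => hP.1 _
  refine ⟨fun v => ∑ u, ∑ uh, PUUV (u, uh, v), b, fun v u => c (v, u),
    ⟨fun v => Finset.sum_nonneg fun _ _ => Finset.sum_nonneg fun _ _ => hP.1 _, ?_⟩,
    hb, fun v u => hc (v, u), fun u uh v => ?_⟩
  · rw [← hP.2, Fintype.sum_prod_type, Finset.sum_comm]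
    simp_rw [Fintype.sum_prod_type]
    exact Finset.sum_congr rfl fun _ _ => Finset.sum_comm
  · rw [← hb' v u]
    exact hc' (v, u) uh

lemma KL_mix_eq (a : V → ℝ) (T : V → X × Y × Z → ℝ) (π : X × Y × Z → ℝ) :
    KL (fun r : X × V × Y × Z => a r.2.1 * T r.2.1 (r.1, r.2.2))
        (fun r => a r.2.1 * π (r.1, r.2.2)) =
      if ∀ v, a v ≠ 0 → ∀ t, π t = 0 → T v t = 0 then
        ENNReal.ofReal (∑ v, a v * ∑ t, T v t * Real.log (T v t / π t)) else ⊤ := by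
  let e : V × (X × Y × Z) ≃ X × V × Y × Z :=
    { toFun := fun ⟨v, x, yz⟩ => (x, v, yz)
      invFun := fun ⟨x, v, yz⟩ => (v, x, yz)
      left_inv := fun _ => rfl
      right_inv := fun _ => rfl }
  have hiff : (∀ r : X × V × Y × Z, a r.2.1 * π (r.1, r.2.2) = 0 →
      a r.2.1 * T r.2.1 (r.1, r.2.2) = 0) ↔ ∀ v, a v ≠ 0 → ∀ t, π t = 0 → T v t = 0 := by
    constructor
    · intro h v hv t ht
      have := h (t.1, v, t.2) (by simp [ht])
      exact (mul_eq_zero.1 this).resolve_left hv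
    · intro h r hr
      by_cases h0 : a r.2.1 = 0
      · simp [h0]
      · rw [h _ h0 _ ((mul_eq_zero.1 hr).resolve_left h0), mul_zero]
  have hsum : ∑ r : X × V × Y × Z, a r.2.1 * T r.2.1 (r.1, r.2.2) *
        Real.log (a r.2.1 * T r.2.1 (r.1, r.2.2) / (a r.2.1 * π (r.1, r.2.2))) =
      ∑ v, a v * ∑ t, T v t * Real.log (T v t / π t) := by
    rw [← e.sum_comp, Fintype.sum_prod_type]
    refine Finset.sum_congr rfl fun v _ => ?_
    rw [Finset.mul_sum]
    refine Finset.sum_congr rfl fun t _ => ?_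
    change a v * T v t * Real.log (a v * T v t / (a v * π t)) = _
    by_cases h0 : a v = 0
    · simp [h0]
    · rw [mul_div_mul_left _ _ h0, mul_assoc]
  unfold KL
  rw [hsum]
  simp only [hiff]

end Factored

/-- Reduction of the auxiliary alphabets: the law of `(X, Y, Z)` given `V` and the entropy
`H(BXYZ|U,V)` are kept, and `H(BXYZ|UÛ,V)` does not decrease. -/
lemma exists_reduction_U_Uh {X Y Z B U Uh : Type} [Fintype X] [Fintype Y] [Fintype Z]
    [Fintype B] [Fintype U] [Fintype Uh] [Nonempty U] [Nonempty Uh]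
    {b : U → ℝ} {c : U → Uh → ℝ} {Q : U → Uh → X × B × Y × Z → ℝ}
    (hb : IsDist b) (hc : IsKernel c) (hQ : ∀ u uh, ∑ t, Q u uh t = 1) {NU NUh : ℕ}
    (hNU : NU = Fintype.card X * Fintype.card Y * Fintype.card Z + 1)
    (hNUh : NUh = Fintype.card B * Fintype.card X * Fintype.card Y * Fintype.card Z) :
    ∃ (eu : Fin NU → U) (eh : U → Fin NUh → Uh) (b' : Fin NU → ℝ) (c' : U → Fin NUh → ℝ),
      IsDist b' ∧ IsKernel c' ∧
      (∀ u, mix (c' u) (fun i => Q u (eh u i)) = mix (c u) (Q u)) ∧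
      mix b' (fun j => dropB (mix (c (eu j)) (Q (eu j)))) =
        mix b (fun u => dropB (mix (c u) (Q u))) ∧
      ∑ j, b' j * ent (mix (c (eu j)) (Q (eu j))) = ∑ u, b u * ent (mix (c u) (Q u)) ∧
      ∑ u, b u * ∑ uh, c u uh * ent (Q u uh) ≤
        ∑ j, b' j * ∑ i, c' (eu j) i * ent (Q (eu j) (eh (eu j) i)) := by
  have hUh : ∀ u, ∃ (e : Fin NUh → Uh) (w : Fin NUh → ℝ), IsDist w ∧
      mix w (fun i => Q u (e i)) = mix (c u) (Q u) ∧
      ∑ uh, c u uh * ent (Q u uh) ≤ ∑ i, w i * ent (Q u (e i)) := by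
    intro u
    obtain ⟨e, w, h1, -, h3, h4, h5⟩ := exists_fin_weights (Q u) (fun _ => 1)
      (fun uh => by simpa using hQ u uh) (fun uh => ent (Q u uh)) (c u) (hc u).1 NUh
      (by rw [hNUh]; simp only [Fintype.card_prod]; ring)
    exact ⟨e, w, ⟨h1, h4.trans (hc u).2⟩, funext h3, h5⟩
  choose eh c' hc' hmix hent using hUh
  obtain ⟨eu, b', h1, -, h3, h4, h5⟩ := exists_fin_weights
    (fun (u : U) (o : Option (X × Y × Z)) =>
      o.elim (ent (mix (c u) (Q u))) (dropB (mix (c u) (Q u))))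
    (fun o => o.elim 0 fun _ => 1)
    (fun u => by simpa [Fintype.sum_option] using dropB_sum (mix_sum (hc u).2 (hQ u)))
    (fun u => ∑ i, c' u i * ent (Q u (eh u i))) b hb.1 NU
    (by rw [hNU]; simp only [Fintype.card_option, Fintype.card_prod]; ring)
  exact ⟨eu, eh, b', c', ⟨h1, h4.trans hb.2⟩, hc', hmix, funext fun t => h3 (some t), h3 none,
    (Finset.sum_le_sum fun u _ => mul_le_mul_of_nonneg_left (hent u) (hb.1 u)).trans h5⟩

lemma marg_fst_isDist {α β : Type} [Fintype α] [Fintype β] {p : α × β → ℝ} (hp : IsDist p) :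
    IsDist (marg (fun x : α × β => x.1) p) := by
  have h : ∀ a, marg (fun x : α × β => x.1) p a = ∑ b, p (a, b) := fun a =>
    marg_apply_of_equiv p (Equiv.refl _) id Function.injective_id (fun _ _ => rfl) a
  refine ⟨fun a => ?_, ?_⟩
  · rw [h]
    exact Finset.sum_nonneg fun _ _ => hp.1 _
  · simp only [h]
    rw [← Fintype.sum_prod_type', hp.2]

/-- Every feasible value is bounded below by one attained with small alphabets. -/
lemma exists_mem_bDeltaSetBdd_le {X Y Z B : Type} [Fintype X] [Fintype Y] [Fintype Z]
    [Fintype B] {π : X × Y × Z → ℝ} (hπ : IsDist π) {hW hWh : ℝ} {NU NUh : ℕ}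
    (hNU : NU = Fintype.card X * Fintype.card Y * Fintype.card Z + 1)
    (hNUh : NUh = Fintype.card B * Fintype.card X * Fintype.card Y * Fintype.card Z)
    {d : ℝ≥0∞} (hd : d ∈ bDeltaSet X Y Z B π hW hWh false) (hdt : d ≠ ⊤) :
    ∃ d' ∈ bDeltaSetBdd X Y Z B π hW hWh false NU NUh 3, d' ≤ d := by
  obtain ⟨m, mh, l, PUUV, PB, PY, PZ, hP, hB, hY, hZ, h1, h2, rfl⟩ := hd
  obtain ⟨u₀, uh₀, v₀⟩ := hP.nonempty
  have : Nonempty (Fin m) := ⟨u₀⟩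
  have : Nonempty (Fin mh) := ⟨uh₀⟩
  have : Nonempty (Fin l) := ⟨v₀⟩
  have hX := marg_fst_isDist hπ
  set πX := marg (fun p : X × Y × Z => p.1) π
  obtain ⟨a, b, c, ha, hb, hc, hfac⟩ := exists_factorization hP
  set Q := bCond πX PB PY PZ with hQdef
  have hQ : ∀ v u uh, ∑ t, Q v u uh t = 1 := fun v u uh =>
    (bCond_isDist hX hB hY hZ v u uh).2
  simp only [Bool.false_eq_true, if_false, add_zero] at h1
  rw [bJoint_eq_factored hfac] at h1 h2 hdt ⊢
  rw [constraint_U_iff (fun v => (hb v).2) (fun v u => (hc v u).2) hQ] at h1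
  rw [constraint_UUh_iff (fun v => (hb v).2) (fun v u => (hc v u).2) hQ] at h2
  rw [marg_XVYZ, marg_V_eq (fun v => (hb v).2) (fun v u => (hc v u).2) hfac] at hdt ⊢
  set T : Fin l → X × Y × Z → ℝ := fun v => mix (b v) fun u => dropB (mix (c v u) (Q v u))
  have hKL := KL_mix_eq a T π
  rw [hKL] at hdt
  have hac : ∀ v, a v ≠ 0 → ∀ t, π t = 0 → T v t = 0 := by
    by_contra h
    exact hdt (if_neg h)
  rw [if_pos hac] at hKL
  choose eu eh b' c' hb' hc' hR hT hE1 hE2 using fun v =>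
    exists_reduction_U_Uh (hb v) (hc v) (hQ v) hNU hNUh
  let E₁ : Fin l → ℝ := fun v => ∑ u, b v u * ent (mix (c v u) (Q v u)) - ent (T v)
  let E₂ : Fin l → ℝ := fun v =>
    ∑ j, b' v j * ∑ i, c' v (eu v j) i * ent (Q v (eu v j) (eh v (eu v j) i)) - ent (T v)
  obtain ⟨ev, a', ha', hsupp, hF, hsum, hg⟩ := exists_fin_weights
    (fun v => ![1, E₁ v, E₂ v]) ![1, 0, 0] (fun v => by simp [Fin.sum_univ_three])
    (fun v => -∑ t, T v t * Real.log (T v t / π t)) a ha.1 3 (Fintype.card_fin 3)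
  have ha'' : IsDist a' := ⟨ha', hsum.trans ha.2⟩
  let b₁ : Fin 3 → Fin NU → ℝ := fun k => b' (ev k)
  let c₁ : Fin 3 → Fin NU → Fin NUh → ℝ := fun k j => c' (ev k) (eu (ev k) j)
  let P₁ : Fin NU × Fin NUh × Fin 3 → ℝ := fun p => a' p.2.2 * b₁ p.2.2 p.1 * c₁ p.2.2 p.1 p.2.1
  let PB₁ : X × Fin NU × Fin NUh × Fin 3 → B → ℝ := fun s =>
    PB (s.1, eu (ev s.2.2.2) s.2.1, eh (ev s.2.2.2) (eu (ev s.2.2.2) s.2.1) s.2.2.1, ev s.2.2.2)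
  let PY₁ : B × Fin NU × Fin NUh × Fin 3 → Y → ℝ := fun s =>
    PY (s.1, eu (ev s.2.2.2) s.2.1, eh (ev s.2.2.2) (eu (ev s.2.2.2) s.2.1) s.2.2.1, ev s.2.2.2)
  let PZ₁ : B × Fin NU × Fin 3 → Z → ℝ := fun s => PZ (s.1, eu (ev s.2.2) s.2.1, ev s.2.2)
  have hb₁ : IsKernel b₁ := fun k => hb' (ev k)
  have hc₁ : ∀ k, IsKernel (c₁ k) := fun k j => hc' (ev k) (eu (ev k) j)
  have hfac₁ : ∀ u uh v, P₁ (u, uh, v) = a' v * b₁ v u * c₁ v u uh := fun _ _ _ => rfl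
  have hQ₁ : ∀ k j i, ∑ t, bCond πX PB₁ PY₁ PZ₁ k j i t = 1 := fun k j i =>
    hQ (ev k) (eu (ev k) j) (eh (ev k) (eu (ev k) j) i)
  have hR₁ : ∀ k j, mix (c₁ k j) (bCond πX PB₁ PY₁ PZ₁ k j) =
      mix (c (ev k) (eu (ev k) j)) (Q (ev k) (eu (ev k) j)) := fun k j => hR _ _
  have hT₁ : ∀ k, (mix (b₁ k) fun j => dropB (mix (c₁ k j) (bCond πX PB₁ PY₁ PZ₁ k j))) =
      T (ev k) := by
    intro k
    simp only [hR₁]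
    exact hT (ev k)
  refine ⟨_, ⟨NU, NUh, 3, le_rfl, le_rfl, le_rfl, P₁, PB₁, PY₁, PZ₁,
    isDist_factored ha'' hb₁ hc₁, fun _ => hB _, fun _ => hY _, fun _ => hZ _, ?_, ?_, rfl⟩, ?_⟩
  · simp only [Bool.false_eq_true, if_false, add_zero]
    rw [bJoint_eq_factored hfac₁,
      constraint_U_iff (fun v => (hb₁ v).2) (fun v u => (hc₁ v u).2) hQ₁]
    simp only [hT₁]
    refine h1.trans_eq ((hF 1).symm.trans (Finset.sum_congr rfl fun k _ => ?_))
    simp only [hR₁]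
    exact congrArg (fun s => a' k * (s - ent (T (ev k)))) (hE1 (ev k)).symm
  · rw [bJoint_eq_factored hfac₁,
      constraint_UUh_iff (fun v => (hb₁ v).2) (fun v u => (hc₁ v u).2) hQ₁]
    simp only [hT₁]
    refine (h2.trans (Finset.sum_le_sum fun v _ => ?_)).trans_eq (hF 2).symm
    exact mul_le_mul_of_nonneg_left (sub_le_sub_right (hE2 v) _) (ha.1 v)
  · rw [bJoint_eq_factored hfac₁, marg_XVYZ,
      marg_V_eq (fun v => (hb₁ v).2) (fun v u => (hc₁ v u).2) hfac₁]
    refine (congrArg₂ KL (funext fun r : X × Fin 3 × Y × Z =>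
      congrArg (fun t => a' r.2.1 * t (r.1, r.2.2))
      (hT₁ r.2.1)) rfl).le.trans ?_
    refine ((KL_mix_eq a' (fun k => T (ev k)) π).trans (if_pos fun k hk => hac _ (hsupp k hk))
      ).le.trans (le_of_le_of_eq (ENNReal.ofReal_le_ofReal ?_) hKL.symm)
    simpa only [mul_neg, Finset.sum_neg_distrib, neg_le_neg_iff] using hg

lemma bDeltaSetBdd_mono {X Y Z B : Type} [Fintype X] [Fintype Y] [Fintype Z] [Fintype B]
    {π : X × Y × Z → ℝ} {hW hWh : ℝ} {extra : Bool} {m m' mh mh' l : ℕ} (hm : m ≤ m')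
    (hmh : mh ≤ mh') :
    bDeltaSetBdd X Y Z B π hW hWh extra m mh l ⊆ bDeltaSetBdd X Y Z B π hW hWh extra m' mh' l := by
  rintro d ⟨n, nh, k, h1, h2, h3, h⟩
  exact ⟨n, nh, k, h1.trans hm, h2.trans hmh, h3, h⟩

lemma bDeltaSetBdd_subset {X Y Z B : Type} [Fintype X] [Fintype Y] [Fintype Z] [Fintype B]
    {π : X × Y × Z → ℝ} {hW hWh : ℝ} {extra : Bool} {m mh l : ℕ} :
    bDeltaSetBdd X Y Z B π hW hWh extra m mh l ⊆ bDeltaSet X Y Z B π hW hWh extra := by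
  rintro d ⟨n, nh, k, -, -, -, h⟩
  exact ⟨n, nh, k, h⟩

/-- the broadcast quantity `Δ` is unchanged when the minimization is
restricted to `|𝒱| ≤ 3`, `|𝒰| ≤ 3(|𝒳||𝒴||𝒵|+1)` and
`|𝒰̂| ≤ 3(|𝒳||𝒴||𝒵|+1)·|𝓑||𝒳||𝒴||𝒵|`. -/
theorem broadcast_Delta_cardinality_bound
    (X Y Z B : Type) [Fintype X] [Fintype Y] [Fintype Z] [Fintype B]
    (π : X × Y × Z → ℝ) (hπ : IsDist π)
    (hW hWh : ℝ) (hhW : 0 ≤ hW) (hhWh : 0 ≤ hWh) :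
    sInf (bDeltaSet X Y Z B π hW hWh false) =
      sInf (bDeltaSetBdd X Y Z B π hW hWh false
        (3 * (Fintype.card X * Fintype.card Y * Fintype.card Z + 1))
        (3 * (Fintype.card X * Fintype.card Y * Fintype.card Z + 1) *
          (Fintype.card B * Fintype.card X * Fintype.card Y * Fintype.card Z))
        3) := by
  refine le_antisymm (sInf_le_sInf bDeltaSetBdd_subset) (le_sInf fun d hd => ?_)
  by_cases hdt : d = ⊤
  · exact hdt ▸ le_top
  obtain ⟨d', hd', hle⟩ := exists_mem_bDeltaSetBdd_le hπ rfl rfl hd hdt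
  exact (sInf_le (bDeltaSetBdd_mono (by omega) (Nat.le_mul_of_pos_left _ (by positivity)) hd')).trans
    hle


end
end

section
/- Let 𝒳, 𝒴, 𝒵, 𝓑 be finite sets, π_{XYZ} a distribution on 𝒳×𝒴×𝒵, and h_W, h_Ŵ ≥ 0 real numbers. Consider the quantity Δ̂ defined as the minimum, over finite auxiliary alphabets 𝒰, 𝒰̂, 𝒱 and distributions P_{UÛV}, P_{B|XUÛV}, P_{Y|BUÛV}, P_{Z|BUV} satisfying H(U|V) + I(B; Û | XYZUV) ≤ h_W + H(BU|XYZV) and H(UÛ|V) ≤ h_Ŵ + h_W + H(BUÛ|XYZV), of D(P_{YZ|XV} ‖ π_{YZ|X} | π_X P_V), with entropies and mutual informations evaluated under π_X P_{UÛV} P_{B|XUÛV} P_{Y|BUÛV} P_{Z|BUV}. Then the value of Δ̂ is unchanged if the minimization is further restricted to alphabets with |𝒱| ≤ 3, |𝒰| ≤ 3(|𝒳||𝒴||𝒵|+1), and |𝒰̂| ≤ 3(|𝒳||𝒴||𝒵|+1)·(|𝓑||𝒳||𝒴||𝒵|+1). -/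
open scoped BigOperators ENNReal
open Classical

noncomputable section

/-- A nonnegative combination can be rebalanced so that its support has at most as many elements
as there are linear constraints, without increasing a linear objective. -/
lemma exists_nonneg_rebalance {ι κ : Type} [Fintype ι] [Fintype κ]
    (a : ι → κ → ℝ) (obj : ι → ℝ)
    (hrec : ∀ lam : ι → ℝ, (∀ i, 0 ≤ lam i) → (∀ k, ∑ i, lam i * a i k = 0) →
      ∑ i, lam i * obj i = 0)
    (n : ℕ) (w : ι → ℝ) (hw : ∀ i, 0 ≤ w i)
    (hn : (Finset.univ.filter fun i => w i ≠ 0).card ≤ n) :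
    ∃ c : ι → ℝ, (∀ i, 0 ≤ c i) ∧ (∀ k, ∑ i, c i * a i k = ∑ i, w i * a i k) ∧
      ∑ i, c i * obj i ≤ ∑ i, w i * obj i ∧
      (Finset.univ.filter fun i => c i ≠ 0).card ≤ Fintype.card κ := by
  induction n generalizing w with
  | zero => exact ⟨w, hw, fun _ => rfl, le_rfl, hn.trans (Nat.zero_le _)⟩
  | succ n ih =>
    by_cases hcard : (Finset.univ.filter fun i => w i ≠ 0).card ≤ Fintype.card κ
    · exact ⟨w, hw, fun _ => rfl, le_rfl, hcard⟩
    have key : ∃ lam : ι → ℝ, (∀ i, w i = 0 → lam i = 0) ∧ (∀ k, ∑ i, lam i * a i k = 0) ∧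
        (∃ i, lam i ≠ 0) := by
      have hlt : Module.finrank ℝ (κ → ℝ) < (Finset.univ.filter fun i => w i ≠ 0).card := by
        rw [Module.finrank_fintype_fun_eq_card]; omega
      have hdep : ¬ LinearIndependent ℝ
          (fun i : {i // i ∈ Finset.univ.filter fun i => w i ≠ 0} => a i.1) := by
        intro h
        have := h.fintype_card_le_finrank
        rw [Fintype.card_coe] at this
        omega
      rw [Fintype.not_linearIndependent_iff] at hdep
      obtain ⟨g, hg, i₀, hi₀⟩ := hdep
      refine ⟨fun i => if h : i ∈ Finset.univ.filter fun i => w i ≠ 0 then g ⟨i, h⟩ else 0,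
        ?_, ?_, i₀.1, ?_⟩
      · intro i hi
        simp [hi]
      · intro k
        have h1 := congrFun hg k
        simp only [Finset.sum_apply, Pi.smul_apply, smul_eq_mul, Pi.zero_apply] at h1
        refine Eq.trans ?_ h1
        rw [← Finset.sum_subset (Finset.subset_univ (Finset.univ.filter fun i => w i ≠ 0)),
          ← Finset.sum_coe_sort]
        · refine Finset.sum_congr rfl fun i _ => ?_
          dsimp only
          rw [dif_pos i.2]
        · intro i _ hi
          dsimp only
          rw [dif_neg hi, zero_mul]
      · dsimp only
        rw [dif_pos i₀.2]
        exact hi₀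
    have key2 : ∃ lam : ι → ℝ, (∀ i, w i = 0 → lam i = 0) ∧ (∀ k, ∑ i, lam i * a i k = 0) ∧
        (∃ i, lam i < 0) ∧ ∑ i, lam i * obj i ≤ 0 := by
      have main : ∀ lam : ι → ℝ, (∀ i, w i = 0 → lam i = 0) → (∀ k, ∑ i, lam i * a i k = 0) →
          (∃ i, lam i ≠ 0) → ∑ i, lam i * obj i ≤ 0 →
          ∃ lam : ι → ℝ, (∀ i, w i = 0 → lam i = 0) ∧ (∀ k, ∑ i, lam i * a i k = 0) ∧
            (∃ i, lam i < 0) ∧ ∑ i, lam i * obj i ≤ 0 := by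
        intro lam h0 h1 h2 h3
        by_cases hneg : ∃ i, lam i < 0
        · exact ⟨lam, h0, h1, hneg, h3⟩
        · push Not at hneg
          obtain ⟨i, hi⟩ := h2
          refine ⟨fun i => - lam i, fun i hi => by simp [h0 i hi], fun k => by simp [h1 k],
            ⟨i, ?_⟩, ?_⟩
          · have := lt_of_le_of_ne (hneg i) (Ne.symm hi)
            simpa using this
          · simp [hrec lam hneg h1]
      obtain ⟨lam, h0, h1, i, hi⟩ := key
      rcases le_total (∑ i, lam i * obj i) 0 with h | h
      · exact main lam h0 h1 ⟨i, hi⟩ h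
      · exact main (fun i => - lam i) (fun i hi => by simp [h0 i hi]) (fun k => by simp [h1 k])
          ⟨i, by simpa using hi⟩ (by simpa using h)
    obtain ⟨lam, h0, h1, ⟨i₀, hi₀⟩, h3⟩ := key2
    obtain ⟨j, hj, hmin⟩ := Finset.exists_min_image (Finset.univ.filter fun i => lam i < 0)
      (fun i => w i / (- lam i)) ⟨i₀, by simpa using hi₀⟩
    have hj' : lam j < 0 := by simpa using hj
    set θ := w j / (- lam j) with hθ
    have hθ0 : 0 ≤ θ := div_nonneg (hw j) (by linarith)
    have hwj : w j + θ * lam j = 0 := by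
      rw [hθ, div_neg, neg_mul, div_mul_cancel₀ _ hj'.ne, add_neg_cancel]
    have hsum : ∀ f : ι → ℝ, ∑ i, (w i + θ * lam i) * f i =
        ∑ i, w i * f i + θ * ∑ i, lam i * f i := by
      intro f
      rw [Finset.mul_sum, ← Finset.sum_add_distrib]
      exact Finset.sum_congr rfl fun i _ => by ring
    obtain ⟨c, hc0, hc1, hc2, hc3⟩ := ih (fun i => w i + θ * lam i) (by
      intro i
      by_cases hi : lam i < 0
      · have := hmin i (by simpa using hi)
        rw [le_div_iff₀ (by linarith)] at this
        linarith
      · have := mul_nonneg hθ0 (not_lt.mp hi)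
        linarith [hw i]) (by
      have : (Finset.univ.filter fun i => w i + θ * lam i ≠ 0) ⊂
          (Finset.univ.filter fun i => w i ≠ 0) := by
        refine (Finset.ssubset_iff_of_subset ?_).2 ⟨j, ?_, ?_⟩
        · intro i
          simp only [Finset.mem_filter, Finset.mem_univ, true_and]
          intro h hi
          exact h (by rw [hi, h0 i hi]; ring)
        · simp only [Finset.mem_filter, Finset.mem_univ, true_and]
          intro h
          exact hj'.ne (h0 j h)
        · simpa using hwj
      have := Finset.card_lt_card this
      omega)
    refine ⟨c, hc0, fun k => ?_, ?_, hc3⟩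
    · rw [hc1, hsum (fun i => a i k), h1, mul_zero, add_zero]
    · rw [hsum] at hc2
      nlinarith

/-- Carathéodory-type reduction to `Fin N`-indexed weights, where `N` is the number of linear
constraints; `φ` is a combination of the constraints that is nonnegative on every point. -/
lemma exists_fin_reweight {ι κ : Type} [Fintype ι] [Nonempty ι] [Fintype κ] {N : ℕ}
    (hN : Fintype.card κ = N) (a : ι → κ → ℝ) (obj : ι → ℝ) (φ : κ → ℝ)
    (hφ : ∀ i, 0 ≤ ∑ k, φ k * a i k) (hobj : ∀ i, ∑ k, φ k * a i k = 0 → obj i = 0) :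
    ∃ (σ : Fin N → ι) (c : Fin N → ℝ), (∀ j, 0 ≤ c j) ∧
      (∀ k, ∑ j, c j * a (σ j) k = ∑ i, a i k) ∧ ∑ j, c j * obj (σ j) ≤ ∑ i, obj i := by
  obtain ⟨c, hc0, hc1, hc2, hc3⟩ := exists_nonneg_rebalance a obj (by
    intro lam hlam h
    have h2 : ∑ i, lam i * ∑ k, φ k * a i k = 0 := by
      simp_rw [Finset.mul_sum]
      rw [Finset.sum_comm]
      refine Finset.sum_eq_zero fun k _ => ?_
      rw [← mul_zero (φ k), ← h k, Finset.mul_sum]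
      exact Finset.sum_congr rfl fun i _ => by ring
    rw [Finset.sum_eq_zero_iff_of_nonneg fun i _ => mul_nonneg (hlam i) (hφ i)] at h2
    refine Finset.sum_eq_zero fun i hi => ?_
    rcases mul_eq_zero.1 (h2 i hi) with h3 | h3
    · rw [h3, zero_mul]
    · rw [hobj i h3, mul_zero]) _ (fun _ => 1) (fun _ => zero_le_one) le_rfl
  rw [hN] at hc3
  set s := Finset.univ.filter fun i => c i ≠ 0 with hs
  obtain ⟨i₀⟩ := ‹Nonempty ι›
  let e := s.equivFin
  have hsum : ∀ f : ι → ℝ,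
      ∑ j : Fin N, (if h : j.1 < s.card then c (e.symm ⟨j, h⟩) else 0) *
        f (if h : j.1 < s.card then e.symm ⟨j, h⟩ else i₀) = ∑ i, c i * f i := by
    intro f
    have hs1 : ∑ i, c i * f i = ∑ j, c (e.symm j) * f (e.symm j) := by
      rw [e.symm.sum_comp (fun i : s => c i * f i), Finset.sum_coe_sort s (fun i => c i * f i)]
      refine (Finset.sum_subset (Finset.subset_univ s) fun i _ hi => ?_).symm
      have : c i = 0 := by simpa [hs] using hi
      rw [this, zero_mul]
    rw [hs1]
    symm
    refine Fintype.sum_of_injective (Fin.castLE hc3) (Fin.castLE_injective hc3) _ _ ?_ ?_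
    · intro j hj
      have : ¬ j.1 < s.card := fun h => hj ⟨⟨j, h⟩, rfl⟩
      simp [this]
    · intro j
      simp
  refine ⟨fun j => if h : j.1 < s.card then e.symm ⟨j, h⟩ else i₀,
    fun j => if h : j.1 < s.card then c (e.symm ⟨j, h⟩) else 0, ?_, ?_, ?_⟩
  · intro j
    dsimp only
    split_ifs
    exacts [hc0 _, le_rfl]
  · intro k
    rw [hsum (fun i => a i k), hc1]
    simp
  · rw [hsum]
    simpa using hc2

/-- The part of the mixture of the laws `q` with weights `w` carried by the pair `(v, u)`. -/
def pairPart {T U Uh V : Type} [Fintype Uh] (w : U × Uh × V → ℝ) (q : U × Uh × V → T → ℝ)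
    (v : V) (u : U) : T → ℝ :=
  fun t => ∑ uh, w (u, uh, v) * q (u, uh, v) t

/-- The part of the mixture of the laws `q` with weights `w` carried by `v`. -/
def letterPart {T U Uh V : Type} [Fintype U] [Fintype Uh] (w : U × Uh × V → ℝ)
    (q : U × Uh × V → T → ℝ) (v : V) : T → ℝ :=
  fun t => ∑ u, pairPart w q v u t

/-- The functional representing `H(U|V) + I(B;Û|XYZUV) - H(BU|XYZV)`. -/
def firstFunctional {T U Uh V : Type} [Fintype U] [Fintype Uh] [Fintype V] (E : (T → ℝ) → ℝ)
    (w : U × Uh × V → ℝ) (q : U × Uh × V → T → ℝ) (g : U × Uh × V → ℝ) : ℝ :=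
  ∑ v, (E (letterPart w q v) -
    ∑ u, (E (pairPart w q v u) + ∑ uh, w (u, uh, v) * g (u, uh, v)))

/-- The functional representing `H(UÛ|V) - H(BUÛ|XYZV)`. -/
def secondFunctional {T U Uh V : Type} [Fintype U] [Fintype Uh] [Fintype V] (E : (T → ℝ) → ℝ)
    (w : U × Uh × V → ℝ) (q : U × Uh × V → T → ℝ) (h : U × Uh × V → ℝ) : ℝ :=
  ∑ v, (E (letterPart w q v) - ∑ u, ∑ uh, w (u, uh, v) * h (u, uh, v))

/-- Translation of letters of the reduced auxiliary alphabets into original letters. -/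
def pullLetters {U Uh V U' Uh' V' : Type} (σ : V' → V) (τ : V' → U' → U)
    (ρ : V' → U' → Uh' → Uh) (p : U' × Uh' × V') : U × Uh × V :=
  (τ p.2.2 p.1, ρ p.2.2 p.1 p.2.1, σ p.2.2)

/-- The auxiliary alphabets can be reduced to sizes `N`, `N` and `3` without increasing either
constraint functional or the objective, by successive reweighting of `Û`, `U` and `V`. -/
theorem exists_reduced_weights {T U Uh V : Type} [Fintype T] [Fintype U] [Fintype Uh] [Fintype V]
    [Nonempty U] [Nonempty Uh] [Nonempty V] {N : ℕ} (hN : Fintype.card T + 1 = N)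
    (w : U × Uh × V → ℝ) (q : U × Uh × V → T → ℝ) (g h : U × Uh × V → ℝ) (E D : (T → ℝ) → ℝ)
    (hE : ∀ c : ℝ, 0 ≤ c → ∀ s : T → ℝ, E (fun t => c * s t) = c * E s)
    (hD : ∀ c : ℝ, 0 ≤ c → ∀ s : T → ℝ, D (fun t => c * s t) = c * D s)
    (hw : ∀ p, 0 ≤ w p) (hq : ∀ p t, 0 ≤ q p t) (hq1 : ∀ p, ∑ t, q p t = 1) :
    ∃ (σ : Fin 3 → V) (τ : Fin 3 → Fin N → U) (ρ : Fin 3 → Fin N → Fin N → Uh)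
      (w' : Fin N × Fin N × Fin 3 → ℝ) (c : Fin 3 → ℝ),
      (∀ p, 0 ≤ w' p) ∧
      (∀ i t, letterPart w' (q ∘ pullLetters σ τ ρ) i t = c i * letterPart w q (σ i) t) ∧
      ∑ i, ∑ t, letterPart w' (q ∘ pullLetters σ τ ρ) i t = ∑ v, ∑ t, letterPart w q v t ∧
      firstFunctional E w' (q ∘ pullLetters σ τ ρ) (g ∘ pullLetters σ τ ρ) ≤ firstFunctional E w q g ∧
      secondFunctional E w' (q ∘ pullLetters σ τ ρ) (h ∘ pullLetters σ τ ρ) ≤ secondFunctional E w q h ∧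
      ∑ i, D (letterPart w' (q ∘ pullLetters σ τ ρ) i) ≤ ∑ v, D (letterPart w q v) := by
  have hE0 : E (fun _ => 0) = 0 := by simpa using hE 0 le_rfl (fun _ => 0)
  have hD0 : D (fun _ => 0) = 0 := by simpa using hD 0 le_rfl (fun _ => 0)
  have hcard : Fintype.card (Option T) = N := by rw [Fintype.card_option, hN]
  have hpair0 : ∀ v u t, 0 ≤ pairPart w q v u t := fun v u t =>
    Finset.sum_nonneg fun _ _ => mul_nonneg (hw _) (hq _ _)
  have hletter0 : ∀ v t, 0 ≤ letterPart w q v t := fun v t =>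
    Finset.sum_nonneg fun _ _ => hpair0 _ _ _
  have hmass : ∀ v u, ∑ t, pairPart w q v u t = ∑ uh, w (u, uh, v) := by
    intro v u
    unfold pairPart
    rw [Finset.sum_comm]
    exact Finset.sum_congr rfl fun uh _ => by rw [← Finset.mul_sum, hq1, mul_one]
  have stepUh : ∀ v u, ∃ (ρ : Fin N → Uh) (c : Fin N → ℝ), (∀ k, 0 ≤ c k) ∧
      (∀ t, ∑ k, c k * (w (u, ρ k, v) * q (u, ρ k, v) t) = pairPart w q v u t) ∧
      ∑ k, c k * (w (u, ρ k, v) * h (u, ρ k, v)) = ∑ uh, w (u, uh, v) * h (u, uh, v) ∧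
      ∑ uh, w (u, uh, v) * g (u, uh, v) ≤ ∑ k, c k * (w (u, ρ k, v) * g (u, ρ k, v)) := by
    intro v u
    have hm : ∀ uh, ∑ k : Option T, (k.elim 0 fun _ => 1) *
        (k.elim (w (u, uh, v) * h (u, uh, v)) fun t => w (u, uh, v) * q (u, uh, v) t) =
        w (u, uh, v) := by
      intro uh
      simp [Fintype.sum_option, ← Finset.mul_sum, hq1]
    obtain ⟨ρ, c, hc, h1, h2⟩ := exists_fin_reweight hcard
      (fun uh k => k.elim (w (u, uh, v) * h (u, uh, v)) fun t => w (u, uh, v) * q (u, uh, v) t)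
      (fun uh => - (w (u, uh, v) * g (u, uh, v))) (fun k => k.elim 0 fun _ => 1)
      (fun uh => by rw [hm]; exact hw _) (fun uh h0 => by rw [hm] at h0; rw [h0]; simp)
    refine ⟨ρ, c, hc, fun t => h1 (some t), h1 none, ?_⟩
    simpa using h2
  choose ρ cUh hcUh hρq hρh hρg using stepUh
  have stepU : ∀ v, ∃ (τ : Fin N → U) (c : Fin N → ℝ), (∀ j, 0 ≤ c j) ∧
      (∀ t, ∑ j, c j * pairPart w q v (τ j) t = letterPart w q v t) ∧
      ∑ j, c j * ∑ uh, w (τ j, uh, v) * h (τ j, uh, v) =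
        ∑ u, ∑ uh, w (u, uh, v) * h (u, uh, v) ∧
      ∑ u, (E (pairPart w q v u) +
          ∑ k, cUh v u k * (w (u, ρ v u k, v) * g (u, ρ v u k, v))) ≤
        ∑ j, c j * (E (pairPart w q v (τ j)) +
          ∑ k, cUh v (τ j) k * (w (τ j, ρ v (τ j) k, v) * g (τ j, ρ v (τ j) k, v))) := by
    intro v
    have hm : ∀ u, ∑ k : Option T, (k.elim 0 fun _ => 1) *
        (k.elim (∑ uh, w (u, uh, v) * h (u, uh, v)) fun t => pairPart w q v u t) =
        ∑ t, pairPart w q v u t := by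
      intro u
      simp [Fintype.sum_option]
    obtain ⟨τ, c, hc, h1, h2⟩ := exists_fin_reweight hcard
      (fun u k => k.elim (∑ uh, w (u, uh, v) * h (u, uh, v)) fun t => pairPart w q v u t)
      (fun u => - (E (pairPart w q v u) +
          ∑ k, cUh v u k * (w (u, ρ v u k, v) * g (u, ρ v u k, v))))
      (fun k => k.elim 0 fun _ => 1)
      (fun u => by rw [hm]; exact Finset.sum_nonneg fun _ _ => hpair0 _ _ _)
      (fun u h0 => by
        rw [hm] at h0
        have hz : pairPart w q v u = fun _ => 0 := by
          funext t
          exact (Finset.sum_eq_zero_iff_of_nonneg fun t _ => hpair0 v u t).1 h0 t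
            (Finset.mem_univ t)
        rw [hmass] at h0
        have hwz : ∀ uh, w (u, uh, v) = 0 := fun uh =>
          (Finset.sum_eq_zero_iff_of_nonneg fun _ _ => hw _).1 h0 uh (Finset.mem_univ uh)
        simp [hz, hE0, hwz])
    refine ⟨τ, c, hc, fun t => h1 (some t), h1 none, ?_⟩
    simp only [mul_neg, Finset.sum_neg_distrib] at h2
    exact neg_le_neg_iff.1 h2
  choose τ cU hcU hτq hτh hτg using stepU
  obtain ⟨σ, cV, hcV, h1, h2⟩ := exists_fin_reweight (N := 3) (κ := Fin 3) (by simp)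
    (fun v => ![∑ t, letterPart w q v t,
      E (letterPart w q v) - ∑ j, cU v j * (E (pairPart w q v (τ v j)) +
        ∑ k, cUh v (τ v j) k *
          (w (τ v j, ρ v (τ v j) k, v) * g (τ v j, ρ v (τ v j) k, v))),
      E (letterPart w q v) - ∑ u, ∑ uh, w (u, uh, v) * h (u, uh, v)])
    (fun v => D (letterPart w q v)) ![1, 0, 0]
    (fun v => by
      simp only [Fin.sum_univ_three]
      simpa using Finset.sum_nonneg fun t _ => hletter0 v t)
    (fun v h0 => by
      simp only [Fin.sum_univ_three] at h0
      have h0' : ∑ t, letterPart w q v t = 0 := by simpa using h0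
      have hz : letterPart w q v = fun _ => 0 := by
        funext t
        exact (Finset.sum_eq_zero_iff_of_nonneg fun t _ => hletter0 v t).1 h0' t
          (Finset.mem_univ t)
      rw [hz, hD0])
  have e0 := h1 0
  have e1 := h1 1
  have e2 := h1 2
  simp only [Matrix.cons_val] at e0 e1 e2
  let w' : Fin N × Fin N × Fin 3 → ℝ := fun p =>
    cV p.2.2 * (cU (σ p.2.2) p.1 * (cUh (σ p.2.2) (τ (σ p.2.2) p.1) p.2.1 *
      w (τ (σ p.2.2) p.1, ρ (σ p.2.2) (τ (σ p.2.2) p.1) p.2.1, σ p.2.2)))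
  let R : Fin N × Fin N × Fin 3 → U × Uh × V :=
    pullLetters σ (fun i => τ (σ i)) (fun i j => ρ (σ i) (τ (σ i) j))
  have hpair : ∀ i j, pairPart w' (q ∘ R) i j =
      fun t => (cV i * cU (σ i) j) * pairPart w q (σ i) (τ (σ i) j) t := by
    intro i j
    funext t
    rw [← hρq, Finset.mul_sum]
    exact Finset.sum_congr rfl fun k _ => by simp only [w', R, pullLetters, Function.comp]; ring
  have hletter : ∀ i, letterPart w' (q ∘ R) i = fun t => cV i * letterPart w q (σ i) t := by
    intro i
    funext t
    rw [← hτq, Finset.mul_sum]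
    exact Finset.sum_congr rfl fun j _ => by rw [hpair]; ring
  refine ⟨σ, fun i => τ (σ i), fun i j => ρ (σ i) (τ (σ i) j), w', cV, ?_, ?_, ?_, ?_, ?_, ?_⟩
  · exact fun p => mul_nonneg (hcV _) (mul_nonneg (hcU _ _) (mul_nonneg (hcUh _ _ _) (hw _)))
  · exact fun i t => congrFun (hletter i) t
  · rw [← e0]
    refine Finset.sum_congr rfl fun i _ => ?_
    rw [Finset.mul_sum]
    exact Finset.sum_congr rfl fun t _ => congrFun (hletter i) t
  · calc firstFunctional E w' (q ∘ R) (g ∘ R)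
        = ∑ i, cV i * (E (letterPart w q (σ i)) - ∑ j, cU (σ i) j *
            (E (pairPart w q (σ i) (τ (σ i) j)) + ∑ k, cUh (σ i) (τ (σ i) j) k *
              (w (τ (σ i) j, ρ (σ i) (τ (σ i) j) k, σ i) *
                g (τ (σ i) j, ρ (σ i) (τ (σ i) j) k, σ i)))) := by
          refine Finset.sum_congr rfl fun i _ => ?_
          rw [hletter, hE _ (hcV i), mul_sub, Finset.mul_sum]
          congr 1
          refine Finset.sum_congr rfl fun j _ => ?_
          rw [hpair, hE _ (mul_nonneg (hcV i) (hcU _ _)), mul_add, mul_add, Finset.mul_sum,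
            Finset.mul_sum]
          congr 1
          · ring
          · exact Finset.sum_congr rfl fun k _ => by
              simp only [w', R, pullLetters, Function.comp]; ring
      _ = _ := e1
      _ ≤ firstFunctional E w q g := by
          refine Finset.sum_le_sum fun v _ => sub_le_sub_left (le_trans ?_ (hτg v)) _
          exact Finset.sum_le_sum fun u _ => by linarith [hρg v u]
  · refine le_of_eq ?_
    calc secondFunctional E w' (q ∘ R) (h ∘ R)
        = ∑ i, cV i * (E (letterPart w q (σ i)) -
            ∑ u, ∑ uh, w (u, uh, σ i) * h (u, uh, σ i)) := by
          refine Finset.sum_congr rfl fun i _ => ?_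
          rw [hletter, hE _ (hcV i), mul_sub, ← hτh, Finset.mul_sum]
          congr 1
          refine Finset.sum_congr rfl fun j _ => ?_
          rw [← hρh, Finset.mul_sum, Finset.mul_sum]
          exact Finset.sum_congr rfl fun k _ => by
            simp only [w', R, pullLetters, Function.comp]; ring
      _ = secondFunctional E w q h := e2
  · refine le_trans (le_of_eq ?_) h2
    exact Finset.sum_congr rfl fun i _ => by
      change D (letterPart w' (q ∘ R) i) = _
      rw [hletter, hD _ (hcV i)]

/-- Entropy of a marginal, along a splitting of the sample space into kept and discarded
coordinates. -/
lemma ent_marg {α β β' γ : Type} [Fintype α] [Fintype β] [Fintype β'] [Fintype γ]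
    (f : α → β) (p : α → ℝ) (e : α ≃ β' × γ) (d : β' ≃ β) (hf : ∀ a, f a = d (e a).1) :
    ent (marg f p) = ∑ b, Real.negMulLog (∑ c, p (e.symm (b, c))) := by
  unfold ent
  rw [← d.sum_comp]
  refine Finset.sum_congr rfl fun b _ => congrArg _ ?_
  unfold marg
  rw [← e.symm.sum_comp, Fintype.sum_prod_type, Finset.sum_eq_single b]
  · refine Finset.sum_congr rfl fun c _ => ?_
    rw [if_pos (by simp [hf])]
  · intro b' _ hb
    refine Finset.sum_eq_zero fun c _ => ?_
    rw [if_neg (by simpa [hf] using hb)]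
  · simp

section Joint

variable {X Y Z B U Uh V : Type}

/-- The conditional law of `(B, (X, Y, Z))` given the auxiliary letters `(u, û, v)`. -/
def letterLaw (πX : X → ℝ) (PB : X × U × Uh × V → B → ℝ) (PY : B × U × Uh × V → Y → ℝ)
    (PZ : B × U × V → Z → ℝ) (p : U × Uh × V) (b : B) (t : X × Y × Z) : ℝ :=
  πX t.1 * PB (t.1, p) b * PY (b, p) t.2.1 * PZ (b, p.1, p.2.2) t.2.2

/-- The conditional law of `(X, Y, Z)` given the auxiliary letters `(u, û, v)`. -/
def outputLaw [Fintype B] (πX : X → ℝ) (PB : X × U × Uh × V → B → ℝ)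
    (PY : B × U × Uh × V → Y → ℝ) (PZ : B × U × V → Z → ℝ) (p : U × Uh × V)
    (t : X × Y × Z) : ℝ :=
  ∑ b, letterLaw πX PB PY PZ p b t

/-- Homogeneous extension of the entropy to finite measures. -/
def massEnt {T : Type} [Fintype T] (s : T → ℝ) : ℝ :=
  ∑ t, Real.negMulLog (s t) - Real.negMulLog (∑ t, s t)

lemma massEnt_mul {T : Type} [Fintype T] (c : ℝ) (s : T → ℝ) :
    massEnt (fun t => c * s t) = c * massEnt s := by
  unfold massEnt
  rw [← Finset.mul_sum, Real.negMulLog_mul]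
  simp_rw [Real.negMulLog_mul]
  rw [Finset.sum_add_distrib, ← Finset.sum_mul, ← Finset.mul_sum]
  ring

/-- Homogeneous divergence of a finite measure from the multiple of `π` of the same mass. -/
def massDiv {T : Type} [Fintype T] (π : T → ℝ) (s : T → ℝ) : ℝ :=
  ∑ t, s t * Real.log (s t / ((∑ t, s t) * π t))

lemma massDiv_mul {T : Type} [Fintype T] (π : T → ℝ) (c : ℝ) (s : T → ℝ) :
    massDiv π (fun t => c * s t) = c * massDiv π s := by
  unfold massDiv
  have hs : ∑ t, c * s t = c * ∑ t, s t := (Finset.mul_sum _ _ _).symm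
  rw [Finset.mul_sum, hs]
  refine Finset.sum_congr rfl fun t _ => ?_
  rcases eq_or_ne c 0 with rfl | hc
  · simp
  · rw [mul_assoc, mul_assoc, mul_div_mul_left _ _ hc]

lemma sum_negMulLog_mul {T : Type} [Fintype T] (c : ℝ) (s : T → ℝ) :
    ∑ t, Real.negMulLog (c * s t) =
      (∑ t, s t) * Real.negMulLog c + c * ∑ t, Real.negMulLog (s t) := by
  simp_rw [Real.negMulLog_mul]
  rw [Finset.sum_add_distrib, Finset.sum_mul, Finset.mul_sum]

lemma bJoint_eq (πX : X → ℝ) (w : U × Uh × V → ℝ) (PB : X × U × Uh × V → B → ℝ)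
    (PY : B × U × Uh × V → Y → ℝ) (PZ : B × U × V → Z → ℝ) (x : X) (u : U) (uh : Uh) (v : V) (b : B)
    (y : Y) (z : Z) :
    bJoint πX w PB PY PZ (x, u, uh, v, b, y, z) =
      w (u, uh, v) * letterLaw πX PB PY PZ (u, uh, v) b (x, y, z) := by
  simp only [bJoint, letterLaw]
  ring

variable [Fintype X] [Fintype Y] [Fintype Z] [Fintype B]

lemma letterLaw_nonneg {πX : X → ℝ} {PB : X × U × Uh × V → B → ℝ}
    {PY : B × U × Uh × V → Y → ℝ} {PZ : B × U × V → Z → ℝ} (hX : IsDist πX)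
    (hB : IsKernel PB) (hY : IsKernel PY) (hZ : IsKernel PZ) (p : U × Uh × V) (b : B)
    (t : X × Y × Z) : 0 ≤ letterLaw πX PB PY PZ p b t :=
  mul_nonneg (mul_nonneg (mul_nonneg (hX.1 _) ((hB _).1 _)) ((hY _).1 _)) ((hZ _).1 _)

lemma sum_outputLaw {πX : X → ℝ} {PB : X × U × Uh × V → B → ℝ}
    {PY : B × U × Uh × V → Y → ℝ} {PZ : B × U × V → Z → ℝ} (hX : IsDist πX)
    (hB : IsKernel PB) (hY : IsKernel PY) (hZ : IsKernel PZ) (p : U × Uh × V) :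
    ∑ t, outputLaw πX PB PY PZ p t = 1 := by
  unfold outputLaw
  rw [Finset.sum_comm]
  simp only [letterLaw, Fintype.sum_prod_type, ← Finset.mul_sum, (hZ _).2, (hY _).2, mul_one]
  rw [Finset.sum_comm]
  simp only [← Finset.mul_sum, (hB _).2, mul_one]
  exact hX.2

/-- The entropy of `B` given `(X, Y, Z)` under the conditional law at given letters. -/
def letterCondEnt (πX : X → ℝ) (PB : X × U × Uh × V → B → ℝ)
    (PY : B × U × Uh × V → Y → ℝ) (PZ : B × U × V → Z → ℝ)
    (p : U × Uh × V) : ℝ :=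
  ∑ t, ∑ b, Real.negMulLog (letterLaw πX PB PY PZ p b t) -
    ∑ t, Real.negMulLog (outputLaw πX PB PY PZ p t)

/-- The entropy of `(B, X, Y, Z)` under the conditional law at given letters. -/
def letterEnt (πX : X → ℝ) (PB : X × U × Uh × V → B → ℝ)
    (PY : B × U × Uh × V → Y → ℝ) (PZ : B × U × V → Z → ℝ)
    (p : U × Uh × V) : ℝ :=
  ∑ t, ∑ b, Real.negMulLog (letterLaw πX PB PY PZ p b t)

lemma sum_negMulLog_letterLaw {πX : X → ℝ} (w : U × Uh × V → ℝ) {PB : X × U × Uh × V → B → ℝ}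
    {PY : B × U × Uh × V → Y → ℝ} {PZ : B × U × V → Z → ℝ} (hX : IsDist πX) (hB : IsKernel PB) (hY : IsKernel PY) (hZ : IsKernel PZ)
    (p : U × Uh × V) :
    ∑ t, ∑ b, Real.negMulLog (w p * letterLaw πX PB PY PZ p b t) =
      Real.negMulLog (w p) + w p * letterEnt πX PB PY PZ p := by
  simp only [sum_negMulLog_mul]
  rw [Finset.sum_add_distrib, ← Finset.sum_mul, ← Finset.mul_sum]
  have := sum_outputLaw hX hB hY hZ p
  unfold outputLaw at this
  rw [this, one_mul, letterEnt]

variable [Fintype U] [Fintype Uh] [Fintype V]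

variable (πX : X → ℝ) (w : U × Uh × V → ℝ) (PB : X × U × Uh × V → B → ℝ)
  (PY : B × U × Uh × V → Y → ℝ) (PZ : B × U × V → Z → ℝ)

lemma ent_marg_V_s14 {β : Type} [Fintype β] (f : X × U × Uh × V × B × Y × Z → β)
    (d : V ≃ β) (hf : ∀ q, f q = d q.2.2.2.1) :
    ent (marg f (bJoint πX w PB PY PZ)) =
      ∑ v, Real.negMulLog (∑ t, letterPart w (outputLaw πX PB PY PZ) v t) := by
  rw [ent_marg f _ (⟨fun q => (q.2.2.2.1, (q.1, q.2.2.2.2.2.1, q.2.2.2.2.2.2), q.2.1, q.2.2.1,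
      q.2.2.2.2.1), fun r => (r.2.1.1, r.2.2.1, r.2.2.2.1, r.1, r.2.2.2.2, r.2.1.2.1, r.2.1.2.2),
      fun _ => rfl, fun _ => rfl⟩ : _ ≃ V × ((X × Y × Z) × U × Uh × B)) d hf]
  simp only [letterPart, pairPart, outputLaw, Equiv.coe_fn_symm_mk, bJoint_eq, Finset.mul_sum,
    Fintype.sum_prod_type]

lemma ent_marg_UV_s14 {β : Type} [Fintype β] (f : X × U × Uh × V × B × Y × Z → β)
    (d : V × U ≃ β) (hf : ∀ q, f q = d (q.2.2.2.1, q.2.1)) :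
    ent (marg f (bJoint πX w PB PY PZ)) =
      ∑ v, ∑ u, Real.negMulLog (∑ t, pairPart w (outputLaw πX PB PY PZ) v u t) := by
  rw [ent_marg f _ (⟨fun q => ((q.2.2.2.1, q.2.1), (q.1, q.2.2.2.2.2.1, q.2.2.2.2.2.2), q.2.2.1,
      q.2.2.2.2.1), fun r => (r.2.1.1, r.1.2, r.2.2.1, r.1.1, r.2.2.2, r.2.1.2.1, r.2.1.2.2),
      fun _ => rfl, fun _ => rfl⟩ : _ ≃ (V × U) × ((X × Y × Z) × Uh × B)) d hf]
  simp only [pairPart, outputLaw, Equiv.coe_fn_symm_mk, bJoint_eq, Finset.mul_sum,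
    Fintype.sum_prod_type]

lemma ent_marg_UUhV_s14 {β : Type} [Fintype β] (f : X × U × Uh × V × B × Y × Z → β)
    (d : V × U × Uh ≃ β) (hf : ∀ q, f q = d (q.2.2.2.1, q.2.1, q.2.2.1)) :
    ent (marg f (bJoint πX w PB PY PZ)) =
      ∑ v, ∑ u, ∑ uh, Real.negMulLog
        (w (u, uh, v) * ∑ t, outputLaw πX PB PY PZ (u, uh, v) t) := by
  rw [ent_marg f _ (⟨fun q => ((q.2.2.2.1, q.2.1, q.2.2.1), (q.1, q.2.2.2.2.2.1, q.2.2.2.2.2.2),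
      q.2.2.2.2.1), fun r => (r.2.1.1, r.1.2.1, r.1.2.2, r.1.1, r.2.2, r.2.1.2.1, r.2.1.2.2),
      fun _ => rfl, fun _ => rfl⟩ : _ ≃ (V × U × Uh) × ((X × Y × Z) × B)) d hf]
  simp only [outputLaw, Equiv.coe_fn_symm_mk, bJoint_eq, Finset.mul_sum,
    Fintype.sum_prod_type]

lemma ent_marg_XYZV_s14 {β : Type} [Fintype β] (f : X × U × Uh × V × B × Y × Z → β)
    (d : V × (X × Y × Z) ≃ β)
    (hf : ∀ q, f q = d (q.2.2.2.1, q.1, q.2.2.2.2.2.1, q.2.2.2.2.2.2)) :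
    ent (marg f (bJoint πX w PB PY PZ)) =
      ∑ v, ∑ t, Real.negMulLog (letterPart w (outputLaw πX PB PY PZ) v t) := by
  rw [ent_marg f _ (⟨fun q => ((q.2.2.2.1, (q.1, q.2.2.2.2.2.1, q.2.2.2.2.2.2)), q.2.1, q.2.2.1,
      q.2.2.2.2.1), fun r => (r.1.2.1, r.2.1, r.2.2.1, r.1.1, r.2.2.2, r.1.2.2.1, r.1.2.2.2),
      fun _ => rfl, fun _ => rfl⟩ : _ ≃ (V × (X × Y × Z)) × (U × Uh × B)) d hf]
  simp only [letterPart, pairPart, outputLaw, Equiv.coe_fn_symm_mk, bJoint_eq, Finset.mul_sum,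
    Fintype.sum_prod_type]

lemma ent_marg_XYZUV {β : Type} [Fintype β] (f : X × U × Uh × V × B × Y × Z → β)
    (d : (V × U) × (X × Y × Z) ≃ β)
    (hf : ∀ q, f q = d ((q.2.2.2.1, q.2.1), q.1, q.2.2.2.2.2.1, q.2.2.2.2.2.2)) :
    ent (marg f (bJoint πX w PB PY PZ)) =
      ∑ v, ∑ u, ∑ t, Real.negMulLog (pairPart w (outputLaw πX PB PY PZ) v u t) := by
  rw [ent_marg f _ (⟨fun q => (((q.2.2.2.1, q.2.1), (q.1, q.2.2.2.2.2.1, q.2.2.2.2.2.2)), q.2.2.1,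
      q.2.2.2.2.1), fun r => (r.1.2.1, r.1.1.2, r.2.1, r.1.1.1, r.2.2, r.1.2.2.1, r.1.2.2.2),
      fun _ => rfl, fun _ => rfl⟩ : _ ≃ ((V × U) × (X × Y × Z)) × (Uh × B)) d hf]
  simp only [pairPart, outputLaw, Equiv.coe_fn_symm_mk, bJoint_eq, Finset.mul_sum,
    Fintype.sum_prod_type]

lemma ent_marg_XYZUUhV {β : Type} [Fintype β] (f : X × U × Uh × V × B × Y × Z → β)
    (d : (V × U × Uh) × (X × Y × Z) ≃ β)
    (hf : ∀ q, f q = d ((q.2.2.2.1, q.2.1, q.2.2.1), q.1, q.2.2.2.2.2.1, q.2.2.2.2.2.2)) :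
    ent (marg f (bJoint πX w PB PY PZ)) =
      ∑ v, ∑ u, ∑ uh, ∑ t, Real.negMulLog
        (w (u, uh, v) * outputLaw πX PB PY PZ (u, uh, v) t) := by
  rw [ent_marg f _ (⟨fun q => (((q.2.2.2.1, q.2.1, q.2.2.1),
      (q.1, q.2.2.2.2.2.1, q.2.2.2.2.2.2)), q.2.2.2.2.1),
      fun r => (r.1.2.1, r.1.1.2.1, r.1.1.2.2, r.1.1.1, r.2, r.1.2.2.1, r.1.2.2.2),
      fun _ => rfl, fun _ => rfl⟩ : _ ≃ ((V × U × Uh) × (X × Y × Z)) × B) d hf]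
  simp only [outputLaw, Equiv.coe_fn_symm_mk, bJoint_eq, Finset.mul_sum, Fintype.sum_prod_type]

lemma ent_marg_all {β : Type} [Fintype β] (f : X × U × Uh × V × B × Y × Z → β)
    (d : (V × U × Uh) × (X × Y × Z) × B ≃ β)
    (hf : ∀ q, f q =
      d ((q.2.2.2.1, q.2.1, q.2.2.1), (q.1, q.2.2.2.2.2.1, q.2.2.2.2.2.2), q.2.2.2.2.1)) :
    ent (marg f (bJoint πX w PB PY PZ)) =
      ∑ v, ∑ u, ∑ uh, ∑ t, ∑ b, Real.negMulLog
        (w (u, uh, v) * letterLaw πX PB PY PZ (u, uh, v) b t) := by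
  rw [ent_marg f _ (⟨fun q => (((q.2.2.2.1, q.2.1, q.2.2.1),
      (q.1, q.2.2.2.2.2.1, q.2.2.2.2.2.2), q.2.2.2.2.1), ()),
      fun r => (r.1.2.1.1, r.1.1.2.1, r.1.1.2.2, r.1.1.1, r.1.2.2, r.1.2.1.2.1, r.1.2.1.2.2),
      fun _ => rfl, fun _ => rfl⟩ : _ ≃ ((V × U × Uh) × (X × Y × Z) × B) × Unit) d hf]
  simp only [Equiv.coe_fn_symm_mk, bJoint_eq, Fintype.sum_prod_type, Finset.univ_unique,
    Finset.sum_singleton]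

variable {πX PB PY PZ}

lemma firstConstraint_eq (hX : IsDist πX) (hB : IsKernel PB) (hY : IsKernel PY)
    (hZ : IsKernel PZ) :
    condEnt (fun q : X × U × Uh × V × B × Y × Z => q.2.1) (fun q => q.2.2.2.1)
        (bJoint πX w PB PY PZ) +
      condMI (fun q : X × U × Uh × V × B × Y × Z => q.2.2.2.2.1) (fun q => q.2.2.1)
        (fun q => (q.1, q.2.2.2.2.2.1, q.2.2.2.2.2.2, q.2.1, q.2.2.2.1))
        (bJoint πX w PB PY PZ) -
      condEnt (fun q : X × U × Uh × V × B × Y × Z => (q.2.2.2.2.1, q.2.1))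
        (fun q => (q.1, q.2.2.2.2.2.1, q.2.2.2.2.2.2, q.2.2.2.1)) (bJoint πX w PB PY PZ) =
      firstFunctional massEnt w (outputLaw πX PB PY PZ) (letterCondEnt πX PB PY PZ) := by
  have hBXYZUV : ent (marg (fun q : X × U × Uh × V × B × Y × Z =>
        (q.2.2.2.2.1, (q.1, q.2.2.2.2.2.1, q.2.2.2.2.2.2, q.2.1, q.2.2.2.1)))
        (bJoint πX w PB PY PZ)) =
      ent (marg (fun q : X × U × Uh × V × B × Y × Z =>
        ((q.2.2.2.2.1, q.2.1), (q.1, q.2.2.2.2.2.1, q.2.2.2.2.2.2, q.2.2.2.1)))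
        (bJoint πX w PB PY PZ)) := by
    let e : X × U × Uh × V × B × Y × Z ≃ (B × X × Y × Z × U × V) × Uh :=
      ⟨fun q => ((q.2.2.2.2.1, q.1, q.2.2.2.2.2.1, q.2.2.2.2.2.2, q.2.1, q.2.2.2.1), q.2.2.1),
        fun r => (r.1.2.1, r.1.2.2.2.2.1, r.2, r.1.2.2.2.2.2, r.1.1, r.1.2.2.1, r.1.2.2.2.1),
        fun _ => rfl, fun _ => rfl⟩
    exact (ent_marg _ _ e (Equiv.refl _) fun _ => rfl).trans (ent_marg _ _ e
      ⟨fun r => ((r.1, r.2.2.2.2.1), r.2.1, r.2.2.1, r.2.2.2.1, r.2.2.2.2.2),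
        fun r => (r.1.1, r.2.1, r.2.2.1, r.2.2.2.1, r.1.2, r.2.2.2.2), fun _ => rfl,
        fun _ => rfl⟩ fun _ => rfl).symm
  unfold condMI condEnt
  rw [hBXYZUV,
    ent_marg_UV_s14 πX w PB PY PZ (fun q => (q.2.1, q.2.2.2.1)) (Equiv.prodComm _ _) fun _ => rfl,
    ent_marg_V_s14 πX w PB PY PZ (fun q => q.2.2.2.1) (Equiv.refl _) fun _ => rfl,
    ent_marg_XYZUV πX w PB PY PZ (fun q => (q.1, q.2.2.2.2.2.1, q.2.2.2.2.2.2, q.2.1, q.2.2.2.1))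
      ⟨fun r => (r.2.1, r.2.2.1, r.2.2.2, r.1.2, r.1.1),
        fun r => ((r.2.2.2.2, r.2.2.2.1), r.1, r.2.1, r.2.2.1), fun _ => rfl, fun _ => rfl⟩
      fun _ => rfl,
    ent_marg_XYZV_s14 πX w PB PY PZ (fun q => (q.1, q.2.2.2.2.2.1, q.2.2.2.2.2.2, q.2.2.2.1))
      ⟨fun r => (r.2.1, r.2.2.1, r.2.2.2, r.1), fun r => (r.2.2.2, r.1, r.2.1, r.2.2.1),
        fun _ => rfl, fun _ => rfl⟩ fun _ => rfl,
    ent_marg_XYZUUhV πX w PB PY PZ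
      (fun q => (q.2.2.1, (q.1, q.2.2.2.2.2.1, q.2.2.2.2.2.2, q.2.1, q.2.2.2.1)))
      ⟨fun r => (r.1.2.2, r.2.1, r.2.2.1, r.2.2.2, r.1.2.1, r.1.1),
        fun r => ((r.2.2.2.2.2, r.2.2.2.2.1, r.1), r.2.1, r.2.2.1, r.2.2.2.1), fun _ => rfl,
        fun _ => rfl⟩ fun _ => rfl,
    ent_marg_all πX w PB PY PZ
      (fun q => ((q.2.2.2.2.1, q.2.2.1), (q.1, q.2.2.2.2.2.1, q.2.2.2.2.2.2, q.2.1, q.2.2.2.1)))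
      ⟨fun r => ((r.2.2, r.1.2.2), r.2.1.1, r.2.1.2.1, r.2.1.2.2, r.1.2.1, r.1.1),
        fun r => ((r.2.2.2.2.2, r.2.2.2.2.1, r.1.2), (r.2.1, r.2.2.1, r.2.2.2.1), r.1.1),
        fun _ => rfl, fun _ => rfl⟩ fun _ => rfl]
  simp only [sum_negMulLog_letterLaw w hX hB hY hZ]
  simp only [sum_negMulLog_mul,
    sum_outputLaw hX hB hY hZ, one_mul, firstFunctional, massEnt, letterCondEnt, letterEnt,
    mul_sub, Finset.sum_add_distrib, Finset.sum_sub_distrib]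
  ring

lemma secondConstraint_eq (hX : IsDist πX) (hB : IsKernel PB) (hY : IsKernel PY)
    (hZ : IsKernel PZ) :
    condEnt (fun q : X × U × Uh × V × B × Y × Z => (q.2.1, q.2.2.1)) (fun q => q.2.2.2.1)
        (bJoint πX w PB PY PZ) -
      condEnt (fun q : X × U × Uh × V × B × Y × Z => (q.2.2.2.2.1, q.2.1, q.2.2.1))
        (fun q => (q.1, q.2.2.2.2.2.1, q.2.2.2.2.2.2, q.2.2.2.1)) (bJoint πX w PB PY PZ) =
      secondFunctional massEnt w (outputLaw πX PB PY PZ) (letterEnt πX PB PY PZ) := by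
  unfold condEnt
  rw [ent_marg_UUhV_s14 πX w PB PY PZ (fun q => ((q.2.1, q.2.2.1), q.2.2.2.1))
      (Equiv.prodComm _ _) fun _ => rfl,
    ent_marg_V_s14 πX w PB PY PZ (fun q => q.2.2.2.1) (Equiv.refl _) fun _ => rfl,
    ent_marg_XYZV_s14 πX w PB PY PZ (fun q => (q.1, q.2.2.2.2.2.1, q.2.2.2.2.2.2, q.2.2.2.1))
      ⟨fun r => (r.2.1, r.2.2.1, r.2.2.2, r.1), fun r => (r.2.2.2, r.1, r.2.1, r.2.2.1),
        fun _ => rfl, fun _ => rfl⟩ fun _ => rfl,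
    ent_marg_all πX w PB PY PZ
      (fun q => ((q.2.2.2.2.1, q.2.1, q.2.2.1),
        (q.1, q.2.2.2.2.2.1, q.2.2.2.2.2.2, q.2.2.2.1)))
      ⟨fun r => ((r.2.2, r.1.2.1, r.1.2.2), r.2.1.1, r.2.1.2.1, r.2.1.2.2, r.1.1),
        fun r => ((r.2.2.2.2, r.1.2.1, r.1.2.2), (r.2.1, r.2.2.1, r.2.2.2.1), r.1.1),
        fun _ => rfl, fun _ => rfl⟩ fun _ => rfl]
  simp only [sum_negMulLog_letterLaw w hX hB hY hZ,
    sum_outputLaw hX hB hY hZ, mul_one, secondFunctional, massEnt,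
    Finset.sum_add_distrib, Finset.sum_sub_distrib]
  ring

lemma marg_XVYZ_s14 (x : X) (v : V) (y : Y) (z : Z) :
    marg (fun q : X × U × Uh × V × B × Y × Z => (q.1, q.2.2.2.1, q.2.2.2.2.2.1, q.2.2.2.2.2.2))
      (bJoint πX w PB PY PZ) (x, v, y, z) =
      letterPart w (outputLaw πX PB PY PZ) v (x, y, z) := by
  unfold marg
  simp only [Fintype.sum_prod_type, Prod.mk.injEq, ite_and, bJoint_eq, letterPart, pairPart,
    outputLaw, Finset.mul_sum]
  simp [Finset.sum_ite_irrel]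

lemma marg_V (hX : IsDist πX) (hB : IsKernel PB) (hY : IsKernel PY) (hZ : IsKernel PZ) (v : V) :
    marg (fun p : U × Uh × V => p.2.2) w v =
      ∑ t, letterPart w (outputLaw πX PB PY PZ) v t := by
  have hm : marg (fun p : U × Uh × V => p.2.2) w v = ∑ u, ∑ uh, w (u, uh, v) := by
    simp only [marg, Fintype.sum_prod_type, Finset.sum_ite_eq', Finset.mem_univ, if_true]
  simp only [hm, letterPart, pairPart]
  rw [Finset.sum_comm (s := (Finset.univ : Finset (X × Y × Z)))]
  refine Finset.sum_congr rfl fun u _ => ?_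
  rw [Finset.sum_comm]
  refine Finset.sum_congr rfl fun uh _ => ?_
  have := sum_outputLaw hX hB hY hZ (u, uh, v)
  rw [← Finset.mul_sum, this, mul_one]

lemma sum_weights_eq (hX : IsDist πX) (hB : IsKernel PB) (hY : IsKernel PY) (hZ : IsKernel PZ) :
    ∑ p, w p = ∑ v, ∑ t, letterPart w (outputLaw πX PB PY PZ) v t := by
  simp only [← marg_V w hX hB hY hZ, marg]
  rw [Finset.sum_comm]
  simp

lemma KL_eq (hX : IsDist πX) (hB : IsKernel PB) (hY : IsKernel PY) (hZ : IsKernel PZ)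
    (π : X × Y × Z → ℝ) :
    KL (marg (fun q : X × U × Uh × V × B × Y × Z =>
          (q.1, q.2.2.2.1, q.2.2.2.2.2.1, q.2.2.2.2.2.2)) (bJoint πX w PB PY PZ))
        (fun r : X × V × Y × Z => marg (fun p : U × Uh × V => p.2.2) w r.2.1 *
          π (r.1, r.2.2.1, r.2.2.2)) =
      if ∀ v t, (∑ t, letterPart w (outputLaw πX PB PY PZ) v t) * π t = 0 →
          letterPart w (outputLaw πX PB PY PZ) v t = 0 then
        ENNReal.ofReal (∑ v, massDiv π (letterPart w (outputLaw πX PB PY PZ) v))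
      else ⊤ := by
  unfold KL
  refine if_congr ?_ (congrArg _ ?_) rfl
  · constructor
    · rintro h v ⟨x, y, z⟩ h0
      rw [← marg_XVYZ_s14]
      refine h (x, v, y, z) ?_
      dsimp only
      rwa [marg_V w hX hB hY hZ]
    · rintro h ⟨x, v, y, z⟩ h0
      rw [marg_XVYZ_s14]
      dsimp only at h0
      rw [marg_V w hX hB hY hZ] at h0
      exact h v (x, y, z) h0
  · simp only [Fintype.sum_prod_type, massDiv, marg_XVYZ_s14, marg_V w hX hB hY hZ]
    rw [Finset.sum_comm]

end Joint

lemma isDist_marg_fst {X T : Type} [Fintype X] [Fintype T] {π : X × T → ℝ} (hπ : IsDist π) :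
    IsDist (marg (fun p : X × T => p.1) π) := by
  refine ⟨fun x => Finset.sum_nonneg fun p _ => ?_, ?_⟩
  · split_ifs
    exacts [hπ.1 _, le_rfl]
  · simp only [marg]
    rw [Finset.sum_comm]
    simpa using hπ.2

/-- the broadcast quantity `Δ̂` is unchanged when the minimization is
restricted to `|𝒱| ≤ 3`, `|𝒰| ≤ 3(|𝒳||𝒴||𝒵|+1)` and
`|𝒰̂| ≤ 3(|𝒳||𝒴||𝒵|+1)·(|𝓑||𝒳||𝒴||𝒵|+1)`. -/
theorem broadcast_DeltaHat_cardinality_bound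
    (X Y Z B : Type) [Fintype X] [Fintype Y] [Fintype Z] [Fintype B]
    (π : X × Y × Z → ℝ) (hπ : IsDist π)
    (hW hWh : ℝ) (hhW : 0 ≤ hW) (hhWh : 0 ≤ hWh) :
    sInf (bDeltaSet X Y Z B π hW hWh true) =
      sInf (bDeltaSetBdd X Y Z B π hW hWh true
        (3 * (Fintype.card X * Fintype.card Y * Fintype.card Z + 1))
        (3 * (Fintype.card X * Fintype.card Y * Fintype.card Z + 1) *
          (Fintype.card B * Fintype.card X * Fintype.card Y * Fintype.card Z + 1))
        3) := by
  have hX := isDist_marg_fst hπ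
  refine le_antisymm (le_sInf ?_) (le_sInf ?_)
  · rintro d ⟨m, mh, l, -, -, -, hd⟩
    exact sInf_le ⟨m, mh, l, hd⟩
  rintro d ⟨m, mh, l, w, PB, PY, PZ, hw, hB, hY, hZ, h1, h2, rfl⟩
  rw [KL_eq w hX hB hY hZ]
  split_ifs with habs
  swap
  · exact le_top
  rw [if_pos rfl, ← sub_le_iff_le_add, firstConstraint_eq w hX hB hY hZ] at h1
  rw [← sub_le_iff_le_add, secondConstraint_eq w hX hB hY hZ] at h2
  have hne : Nonempty (Fin m × Fin mh × Fin l) := by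
    by_contra hne
    rw [not_nonempty_iff] at hne
    simpa using hw.2
  obtain ⟨u₀, uh₀, v₀⟩ := hne
  have : Nonempty (Fin m) := ⟨u₀⟩
  have : Nonempty (Fin mh) := ⟨uh₀⟩
  have : Nonempty (Fin l) := ⟨v₀⟩
  obtain ⟨N, hN⟩ : ∃ N, N = Fintype.card X * Fintype.card Y * Fintype.card Z + 1 := ⟨_, rfl⟩
  rw [← hN]
  obtain ⟨σ, τ, ρ, w', c, hw', hletter, hmass, hF1, hF2, hD⟩ := exists_reduced_weights
    (N := N) (by simp [hN, mul_assoc]) w (outputLaw _ PB PY PZ) (letterCondEnt _ PB PY PZ)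
    (letterEnt _ PB PY PZ) massEnt (massDiv π) (fun c _ => massEnt_mul c)
    (fun c _ => massDiv_mul π c) hw.1
    (fun p t => Finset.sum_nonneg fun b _ => letterLaw_nonneg hX hB hY hZ p b t)
    (sum_outputLaw hX hB hY hZ)
  let PB' : X × Fin N × Fin N × Fin 3 → B → ℝ := fun p => PB (p.1, pullLetters σ τ ρ p.2)
  let PY' : B × Fin N × Fin N × Fin 3 → Y → ℝ := fun p => PY (p.1, pullLetters σ τ ρ p.2)
  let PZ' : B × Fin N × Fin 3 → Z → ℝ := fun p => PZ (p.1, τ p.2.2 p.2.1, σ p.2.2)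
  have hB' : IsKernel PB' := fun p => hB _
  have hY' : IsKernel PY' := fun p => hY _
  have hZ' : IsKernel PZ' := fun p => hZ _
  have hw1 : IsDist w' := by
    refine ⟨hw', ?_⟩
    rw [sum_weights_eq w' hX hB' hY' hZ', ← hw.2, sum_weights_eq w hX hB hY hZ]
    exact hmass
  refine le_trans (sInf_le ⟨N, N, 3, by omega, ?_, le_rfl, w', PB', PY', PZ', hw1, hB', hY', hZ',
    ?_, ?_, rfl⟩) ?_
  · have : 0 < Fintype.card B * Fintype.card X * Fintype.card Y * Fintype.card Z + 1 :=
      Nat.succ_pos _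
    nlinarith
  · rw [if_pos rfl, ← sub_le_iff_le_add, firstConstraint_eq w' hX hB' hY' hZ']
    exact hF1.trans h1
  · rw [← sub_le_iff_le_add, secondConstraint_eq w' hX hB' hY' hZ']
    exact hF2.trans h2
  · rw [KL_eq w' hX hB' hY' hZ', if_pos]
    · exact ENNReal.ofReal_le_ofReal hD
    · intro i t h0
      have hl : ∀ t, letterPart w' (outputLaw (marg (fun p : X × Y × Z => p.1) π) PB' PY' PZ') i t
          = c i * letterPart w (outputLaw (marg (fun p : X × Y × Z => p.1) π) PB PY PZ) (σ i) t :=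
        hletter i
      simp only [hl, ← Finset.mul_sum, mul_assoc, mul_eq_zero] at h0 ⊢
      refine h0.imp_right fun h0 => habs _ _ ?_
      rcases h0 with h0 | h0 <;> rw [h0] <;> simp

end
end

section
/- One-shot privacy amplification by random binning: Let 𝒳, 𝒴 be finite sets and ℳ a finite set with |ℳ| = M ≥ 1. Let C = {M(x)}_{x∈𝒳} be a random codebook where the M(x), x ∈ 𝒳, are drawn independently and uniformly from ℳ, and set f_C(x) = M(x). Then for every joint distribution P_{XY} on 𝒳×𝒴 and every s ∈ (0,1], the expectation over the random codebook satisfies exp(s · D_{1+s}(P_{f_C(X)|Y,C} ‖ Unif(ℳ) | P_Y P_C)) ≤ 1 + exp(−s·(H_{1+s}(X|Y) − log M)), where H_{1+s}(X|Y) = −(1/s) log Σ_y P_Y(y) Σ_x P_{X|Y}(x|y)^{1+s} is the conditional Rényi entropy of order 1+s under P_{XY}, and D_{1+s} is the conditional Rényi divergence of order 1+s. -/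
open scoped BigOperators ENNReal
open Classical

noncomputable section

/-- `exp(s · D_{1+s}(p ‖ q)) = Σ_a p(a)^{1+s} q(a)^{-s}`, computed in `ℝ≥0∞`
(so terms with `p a = 0` contribute `0`, and `p a > 0, q a = 0` gives `⊤`). -/
def rexp {α : Type} [Fintype α] (s : ℝ) (p q : α → ℝ) : ℝ≥0∞ :=
  ∑ a, ENNReal.ofReal (p a) ^ (1 + s) * ENNReal.ofReal (q a) ^ (-s)

/-- Two distinct letters collide under at most a fraction `1 / |M|` of all maps `X → M`. -/
lemma card_collision_mul_le {X M : Type} [Fintype X] [Fintype M] {x x' : X} (h : x' ≠ x) :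
    Fintype.card {C : X → M // C x' = C x} * Fintype.card M ≤ Fintype.card (X → M) := by
  rw [← Fintype.card_prod]
  refine Fintype.card_le_of_injective
    (fun p : {C : X → M // C x' = C x} × M => Function.update p.1.1 x p.2) ?_
  rintro ⟨⟨C, hC⟩, m⟩ ⟨⟨D, hD⟩, n⟩ heq
  have hne : ∀ z, z ≠ x → C z = D z := fun z hz => by
    simpa [Function.update_of_ne hz] using congrFun heq z
  have hm : m = n := by simpa using congrFun heq x
  have hCD : C = D := by
    funext z
    by_cases hz : z = x
    · rw [hz, ← hC, ← hD, hne x' h]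
    · exact hne z hz
  subst hm hCD
  rfl

/-- Jensen's inequality for the concave function `z ↦ z ^ s` with `0 < s ≤ 1`. -/
lemma sum_mul_rpow_le_rpow_sum {ι : Type} [Fintype ι] (w z : ι → ℝ≥0∞) (hw : ∑ i, w i = 1)
    {s : ℝ} (hs0 : 0 < s) (hs1 : s ≤ 1) :
    ∑ i, w i * z i ^ s ≤ (∑ i, w i * z i) ^ s := by
  have h := ENNReal.rpow_arith_mean_le_arith_mean_rpow Finset.univ w (fun i => z i ^ s) hw
    (one_le_inv₀ hs0 |>.2 hs1)
  simp only [ENNReal.rpow_rpow_inv hs0.ne'] at h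
  exact (ENNReal.rpow_inv_le_iff hs0).1 h

/-- The average over all codebooks of the `s`-th power of the mass colliding with `x`. -/
lemma sum_rpow_collision_le {X M : Type} [Fintype X] [Fintype M] [Nonempty M]
    (a : X → ℝ≥0∞) (x : X) {w : ℝ≥0∞} (hw : (Fintype.card (X → M) : ℝ≥0∞) * w = 1)
    {s : ℝ} (hs0 : 0 < s) (hs1 : s ≤ 1) :
    ∑ C : X → M, w * (∑ x', if C x' = C x then a x' else 0) ^ s ≤
      a x ^ s + ((Fintype.card M : ℝ≥0∞)⁻¹ * ∑ x', a x') ^ s := by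
  have hw' : ∑ _C : X → M, w = 1 := by simpa using hw
  have hcoll : ∀ x' ∈ Finset.univ.erase x,
      ∑ C : X → M, w * (if C x' = C x then a x' else 0) ≤
        (Fintype.card M : ℝ≥0∞)⁻¹ * a x' := by
    intro x' hx'
    have hcard : (Fintype.card {C : X → M // C x' = C x} : ℝ≥0∞) * Fintype.card M ≤
        Fintype.card (X → M) := by
      exact_mod_cast card_collision_mul_le (M := M) (Finset.ne_of_mem_erase hx')
    have hle : (Fintype.card {C : X → M // C x' = C x} : ℝ≥0∞) * w ≤
        (Fintype.card M : ℝ≥0∞)⁻¹ := by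
      rw [ENNReal.le_inv_iff_mul_le, mul_right_comm, ← hw]
      gcongr
    calc ∑ C : X → M, w * (if C x' = C x then a x' else 0)
        = (Fintype.card {C : X → M // C x' = C x} : ℝ≥0∞) * w * a x' := by
          simp only [mul_ite, mul_zero, ← Finset.sum_filter, Finset.sum_const,
            Fintype.card_subtype, nsmul_eq_mul, mul_assoc]
      _ ≤ _ := by gcongr
  calc ∑ C : X → M, w * (∑ x', if C x' = C x then a x' else 0) ^ s
      ≤ ∑ C : X → M, w * (a x ^ s +
          (∑ x' ∈ Finset.univ.erase x, if C x' = C x then a x' else 0) ^ s) := by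
        gcongr with C
        rw [← Finset.add_sum_erase _ _ (Finset.mem_univ x), if_pos rfl]
        exact ENNReal.rpow_add_le_add_rpow _ _ hs0.le hs1
    _ = a x ^ s + ∑ C : X → M, w *
          (∑ x' ∈ Finset.univ.erase x, if C x' = C x then a x' else 0) ^ s := by
        simp only [mul_add, Finset.sum_add_distrib, ← Finset.sum_mul, hw', one_mul]
    _ ≤ a x ^ s + (∑ C : X → M, w *
          ∑ x' ∈ Finset.univ.erase x, if C x' = C x then a x' else 0) ^ s := by
        gcongr
        exact sum_mul_rpow_le_rpow_sum _ _ hw' hs0 hs1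
    _ ≤ _ := by
        gcongr
        simp only [Finset.mul_sum]
        rw [Finset.sum_comm]
        exact (Finset.sum_le_sum hcoll).trans
          (Finset.sum_le_sum_of_subset (Finset.erase_subset _ _))

/-- The average over all codebooks of the power sum of the binned masses. -/
lemma sum_rpow_binning_le {X M : Type} [Fintype X] [Fintype M] [Nonempty M]
    (a : X → ℝ≥0∞) {w : ℝ≥0∞} (hw : (Fintype.card (X → M) : ℝ≥0∞) * w = 1)
    {s : ℝ} (hs0 : 0 < s) (hs1 : s ≤ 1) :
    ∑ m : M, ∑ C : X → M, w * (∑ x, if C x = m then a x else 0) ^ (1 + s) ≤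
      ∑ x, a x ^ (1 + s) + (Fintype.card M : ℝ≥0∞) ^ (-s) * (∑ x, a x) ^ (1 + s) := by
  have hpow : ∀ z : ℝ≥0∞, z ^ (1 + s) = z * z ^ s := fun z => by
    rw [ENNReal.rpow_add_of_nonneg _ _ zero_le_one hs0.le, ENNReal.rpow_one]
  calc ∑ m : M, ∑ C : X → M, w * (∑ x, if C x = m then a x else 0) ^ (1 + s)
      = ∑ x, a x * ∑ C : X → M, w * (∑ x', if C x' = C x then a x' else 0) ^ s := by
        simp only [hpow, Finset.sum_mul, Finset.mul_sum]
        rw [Finset.sum_comm, Finset.sum_comm (s := (Finset.univ : Finset X))]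
        refine Finset.sum_congr rfl fun C _ => ?_
        rw [Finset.sum_comm]
        refine Finset.sum_congr rfl fun x _ => ?_
        rw [Finset.sum_eq_single (C x)]
        · rw [if_pos rfl, mul_left_comm]
        · intro m _ hm
          rw [if_neg hm.symm, zero_mul, mul_zero]
        · simp
    _ ≤ ∑ x, a x * (a x ^ s + ((Fintype.card M : ℝ≥0∞)⁻¹ * ∑ x', a x') ^ s) := by
        gcongr with x
        exact sum_rpow_collision_le a x hw hs0 hs1
    _ = _ := by
        simp only [mul_add, Finset.sum_add_distrib, ← hpow, ← Finset.sum_mul]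
        rw [ENNReal.mul_rpow_of_nonneg _ _ hs0.le, hpow (∑ x, a x), ENNReal.inv_rpow,
          ENNReal.rpow_neg, mul_left_comm]

lemma rpow_one_add_mul_rpow_neg {z : ℝ≥0∞} (hz : z ≠ ⊤) {s : ℝ} (hs0 : 0 < s) :
    z ^ (1 + s) * z ^ (-s) = z := by
  rcases eq_or_ne z 0 with rfl | h0
  · rw [ENNReal.zero_rpow_of_pos (by linarith), zero_mul]
  · rw [← ENNReal.rpow_add _ _ h0 hz, add_neg_cancel_right, ENNReal.rpow_one]

/-- one-shot privacy amplification by random binning: with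
`C = {M(x)}_{x∈𝒳}` i.i.d. uniform on `ℳ` and `f_C(x) = M(x)`, for every joint
distribution `P_{XY}` and `s ∈ (0,1]`,
`exp(s·D_{1+s}(P_{f_C(X)|Y,C} ‖ Unif(ℳ) | P_Y P_C)) ≤ 1 + exp(-s(H_{1+s}(X|Y) - log|ℳ|))`.
Both sides are expressed in exponentiated form: the left side is
`exp(s·D_{1+s})` of the true joint distribution of `(f_C(X), Y, C)` against the
reference `Unif(ℳ) × P_Y × P_C`. -/
theorem one_shot_privacy_amplification
    (X Y M : Type) [Fintype X] [Fintype Y] [Fintype M] [Nonempty M]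
    (P : X × Y → ℝ) (hP : IsDist P)
    (s : ℝ) (hs0 : 0 < s) (hs1 : s ≤ 1) :
    rexp s
      (fun t : M × Y × (X → M) =>
        (∏ _x : X, ((Fintype.card M : ℝ))⁻¹) *
          ∑ x : X, if t.2.2 x = t.1 then P (x, t.2.1) else 0)
      (fun t : M × Y × (X → M) =>
        ((Fintype.card M : ℝ))⁻¹ * marg Prod.snd P t.2.1 *
          ∏ _x : X, ((Fintype.card M : ℝ))⁻¹) ≤
      1 + (Fintype.card M : ℝ≥0∞) ^ s *
        rexp s P (fun p : X × Y => marg Prod.snd P p.2) := by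
  set A : X → Y → ℝ≥0∞ := fun x y => ENNReal.ofReal (P (x, y)) with hA
  set N : ℝ≥0∞ := (Fintype.card M : ℝ≥0∞) with hN
  set c : ℝ≥0∞ := N⁻¹ ^ Fintype.card X with hc
  have hN0 : N ≠ 0 := by simp [hN]
  have hNtop : N ≠ ⊤ := ENNReal.natCast_ne_top _
  have hNinv : ENNReal.ofReal ((Fintype.card M : ℝ))⁻¹ = N⁻¹ := by
    rw [ENNReal.ofReal_inv_of_pos (by exact_mod_cast Fintype.card_pos), ENNReal.ofReal_natCast]
  have hcprod : ENNReal.ofReal (∏ _x : X, ((Fintype.card M : ℝ))⁻¹) = c := by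
    rw [ENNReal.ofReal_prod_of_nonneg (fun _ _ => by positivity), hNinv, Finset.prod_const,
      Finset.card_univ]
  have hctop : c ≠ ⊤ := ENNReal.pow_ne_top (ENNReal.inv_ne_top.2 hN0)
  have hw : (Fintype.card (X → M) : ℝ≥0∞) * c = 1 := by
    rw [Fintype.card_fun, Nat.cast_pow, ← hN, hc, ← mul_pow, ENNReal.mul_inv_cancel hN0 hNtop,
      one_pow]
  have hAtop : ∀ y, ∑ x, A x y ≠ ⊤ := fun y =>
    ENNReal.sum_ne_top.2 fun _ _ => ENNReal.ofReal_ne_top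
  have hmarg : ∀ y, ENNReal.ofReal (marg Prod.snd P y) = ∑ x, A x y := by
    intro y
    have : marg Prod.snd P y = ∑ x, P (x, y) := by
      simp [marg, Fintype.sum_prod_type]
    rw [this, ENNReal.ofReal_sum_of_nonneg fun x _ => hP.1 _]
  have htotal : ∑ y, ∑ x, A x y = 1 := by
    rw [Finset.sum_comm, ← Fintype.sum_prod_type' (f := A), ← ENNReal.ofReal_one, ← hP.2,
      ENNReal.ofReal_sum_of_nonneg fun p _ => hP.1 p]
  have hbin : ∀ (m : M) (y : Y) (C : X → M),
      ENNReal.ofReal (∑ x : X, if C x = m then P (x, y) else 0) =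
        ∑ x, if C x = m then A x y else 0 := by
    intro m y C
    rw [ENNReal.ofReal_sum_of_nonneg fun x _ => by split_ifs; exacts [hP.1 _, le_rfl]]
    refine Finset.sum_congr rfl fun x _ => ?_
    split_ifs <;> simp [hA]
  have hbintop : ∀ (m : M) (y : Y) (C : X → M), (∑ x, if C x = m then A x y else 0) ≠ ⊤ :=
    fun m y C => hbin m y C ▸ ENNReal.ofReal_ne_top
  have hterm : ∀ (m : M) (y : Y) (C : X → M),
      ENNReal.ofReal ((∏ _x : X, ((Fintype.card M : ℝ))⁻¹) *
          ∑ x : X, if C x = m then P (x, y) else 0) ^ (1 + s) *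
        ENNReal.ofReal (((Fintype.card M : ℝ))⁻¹ * marg Prod.snd P y *
          ∏ _x : X, ((Fintype.card M : ℝ))⁻¹) ^ (-s) =
      (c * (∑ x, if C x = m then A x y else 0) ^ (1 + s)) * (N ^ s * (∑ x, A x y) ^ (-s)) := by
    intro m y C
    rw [ENNReal.ofReal_mul (by positivity), hcprod, hbin,
      ENNReal.ofReal_mul' (by positivity), hcprod, ENNReal.ofReal_mul (by positivity), hNinv,
      hmarg, ENNReal.mul_rpow_of_ne_top hctop (hbintop m y C),
      ENNReal.mul_rpow_of_ne_top (ENNReal.mul_ne_top (ENNReal.inv_ne_top.2 hN0) (hAtop y)) hctop,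
      ENNReal.mul_rpow_of_ne_top (ENNReal.inv_ne_top.2 hN0) (hAtop y), ENNReal.inv_rpow,
      ← ENNReal.rpow_neg, neg_neg]
    nth_rewrite 3 [← rpow_one_add_mul_rpow_neg hctop hs0]
    ring
  unfold rexp
  simp only [Fintype.sum_prod_type, hterm, hmarg]
  rw [Finset.sum_comm]
  simp only [← Finset.sum_mul]
  calc ∑ y, (∑ m : M, ∑ C : X → M, c * (∑ x, if C x = m then A x y else 0) ^ (1 + s)) *
        (N ^ s * (∑ x, A x y) ^ (-s))
      ≤ ∑ y, (∑ x, A x y ^ (1 + s) + N ^ (-s) * (∑ x, A x y) ^ (1 + s)) *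
        (N ^ s * (∑ x, A x y) ^ (-s)) := by
        gcongr with y
        exact sum_rpow_binning_le (fun x => A x y) hw hs0 hs1
    _ = ∑ y, (∑ x, A x y + N ^ s * ∑ x, A x y ^ (1 + s) * (∑ x, A x y) ^ (-s)) := by
        refine Finset.sum_congr rfl fun y _ => ?_
        have hNs : N ^ (-s) * N ^ s = 1 := by
          rw [← ENNReal.rpow_add _ _ hN0 hNtop, neg_add_cancel, ENNReal.rpow_zero]
        rw [add_mul, mul_mul_mul_comm, hNs, one_mul, rpow_one_add_mul_rpow_neg (hAtop y) hs0,
          ← Finset.sum_mul, add_comm]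
        ring
    _ = _ := by
        rw [Finset.sum_add_distrib, htotal, ← Finset.mul_sum, Finset.sum_comm]

end
end

section
/- Conditional one-shot channel resolvability: Let 𝒜, 𝒲, 𝒳, 𝓑, 𝒴 be finite sets. Let C = {X(w)}_{w∈𝒲} be a random codebook with X(w) drawn i.i.d. from a distribution P_X on 𝒳, and f_C(w) = X(w). Then for every s ∈ (0,1], every joint distribution P_{AW} on 𝒜×𝒲, every distribution P_B on 𝓑, every channel P_{Y|XB}, and every conditional distribution Q_{Y|B}: exp(s · D_{1+s}(P_{Y|A,B,C} ‖ Q_{Y|B} | P_A P_B P_C)) ≤ exp(s · D_{1+s}(P_{Y|XB} ‖ Q_{Y|B} | P_X P_B) − s · H_{1+s}(P_{W|A} | P_A)) + exp(s · D_{1+s}(P_{Y|B} ‖ Q_{Y|B} | P_B)), where P_{Y|A,B,C} is induced by the true joint distribution P_C P_{AW} P_B P_{Y|B, X=f_C(W)}, and P_{Y|B} is induced by the ideal joint distribution P_B P_X P_{Y|XB}. -/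
open scoped BigOperators ENNReal
open Classical

noncomputable section

/-- A common finite factor can be pulled out of the Rényi summand `p ^ (1 + s) * q ^ (-s)`. -/
lemma ENNReal.mul_rpow_mul_mul_rpow_neg {s : ℝ} (hs : 0 < s) {c q : ℝ≥0∞} (hc : c ≠ ⊤)
    (hq : q ≠ ⊤) (p : ℝ≥0∞) :
    (c * p) ^ (1 + s) * (c * q) ^ (-s) = c * (p ^ (1 + s) * q ^ (-s)) := by
  have hs' : 0 < 1 + s := by linarith
  rcases eq_or_ne c 0 with rfl | h0
  · simp [ENNReal.zero_rpow_of_pos hs']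
  · have h : c ^ (1 + s) * c ^ (-s) = c := by
      rw [← ENNReal.rpow_add _ _ h0 hc]
      simp
    rw [ENNReal.mul_rpow_of_nonneg _ _ hs'.le, ENNReal.mul_rpow_of_ne_top hc hq,
      mul_mul_mul_comm, h]

/-- The coordinates of an i.i.d. family are pairwise independent and have the common mean. -/
lemma sum_prod_mul_mul_eq_sq {W X : Type} [Fintype W] [Fintype X] {P : X → ℝ≥0∞}
    (hP : ∑ x, P x = 1) (k : X → ℝ≥0∞) {w v : W} (hwv : w ≠ v) :
    ∑ c : W → X, (∏ u, P (c u)) * (k (c w) * k (c v)) = (∑ x, P x * k x) ^ 2 := by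
  have h := Fintype.prod_sum (fun (u : W) (x : X) =>
    P x * ((if u = w then k x else 1) * (if u = v then k x else 1)))
  simp only [Finset.prod_mul_distrib, Finset.prod_ite_eq', Finset.mem_univ, if_true] at h
  rw [← h, ← Finset.mul_prod_erase _ _ (Finset.mem_univ w),
    ← Finset.mul_prod_erase _ _ (Finset.mem_erase.2 ⟨hwv.symm, Finset.mem_univ v⟩),
    Finset.prod_eq_one]
  · simp [hwv, hwv.symm, sq]
  · intro u hu
    simp only [Finset.mem_erase] at hu
    simp [hu.1, hu.2.1, hP]

lemma sum_prod_mul_eq {W X : Type} [Fintype W] [Fintype X] {P : X → ℝ≥0∞}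
    (hP : ∑ x, P x = 1) (k : X → ℝ≥0∞) (w : W) :
    ∑ c : W → X, (∏ u, P (c u)) * k (c w) = ∑ x, P x * k x := by
  have h := Fintype.prod_sum (fun (u : W) (x : X) => P x * (if u = w then k x else 1))
  simp only [Finset.prod_mul_distrib, Finset.prod_ite_eq', Finset.mem_univ, if_true] at h
  rw [← h, ← Finset.mul_prod_erase _ _ (Finset.mem_univ w), Finset.prod_eq_one]
  · simp
  · intro u hu
    simp only [Finset.mem_erase] at hu
    simp [hu.1, hP]

/-- Jensen's inequality for the concave power `x ↦ x ^ s` with unnormalized weights. -/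
lemma ENNReal.sum_mul_rpow_le {ι : Type} [Fintype ι] {s : ℝ} (hs0 : 0 < s) (hs1 : s ≤ 1)
    (u S : ι → ℝ≥0∞) :
    ∑ i, u i * S i ^ s ≤ (∑ i, u i) ^ (1 - s) * (∑ i, u i * S i) ^ s := by
  have h := ENNReal.inner_le_weight_mul_Lp_of_nonneg Finset.univ
    (p := s⁻¹) ((one_le_inv₀ hs0).2 hs1) u (fun i => S i ^ s)
  simpa [← ENNReal.rpow_mul, mul_inv_cancel₀ hs0.ne'] using h

/-- Moment bound of order `1 + s` for a weighted sum over a random codebook. -/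
lemma sum_prod_mul_rpow_le {W X : Type} [Fintype W] [Fintype X] {s : ℝ} (hs0 : 0 < s)
    (hs1 : s ≤ 1) {P : X → ℝ≥0∞} (hP : ∑ x, P x = 1) (k : X → ℝ≥0∞) (p : W → ℝ≥0∞) :
    ∑ c : W → X, (∏ u, P (c u)) * (∑ w, p w * k (c w)) ^ (1 + s) ≤
      (∑ w, p w ^ (1 + s)) * (∑ x, P x * k x ^ (1 + s)) +
        (∑ w, p w) ^ (1 + s) * (∑ x, P x * k x) ^ (1 + s) := by
  have hs' : 0 < 1 + s := by linarith
  have hpow : ∀ x : ℝ≥0∞, x * x ^ s = x ^ (1 + s) := fun x => by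
    rw [ENNReal.rpow_add_of_nonneg _ _ zero_le_one hs0.le, ENNReal.rpow_one]
  set m := ∑ x, P x * k x with hm
  have hcross : ∀ w, ∑ c : W → X, (∏ u, P (c u)) * (p w * k (c w) *
      (∑ v ∈ Finset.univ.erase w, p v * k (c v)) ^ s) ≤
        p w * (∑ v, p v) ^ s * m ^ (1 + s) := by
    intro w
    have hJ := ENNReal.sum_mul_rpow_le hs0 hs1 (fun c : W → X => (∏ u, P (c u)) * k (c w))
      (fun c => ∑ v ∈ Finset.univ.erase w, p v * k (c v))
    have hS : ∑ c : W → X, (∏ u, P (c u)) * k (c w) *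
        (∑ v ∈ Finset.univ.erase w, p v * k (c v)) ≤ (∑ v, p v) * m ^ 2 := by
      simp only [Finset.mul_sum]
      rw [Finset.sum_comm, Finset.sum_mul]
      refine (Finset.sum_le_sum fun v hv => ?_).trans
        (Finset.sum_le_sum_of_subset (Finset.erase_subset w _))
      rw [hm, ← sum_prod_mul_mul_eq_sq hP k (Finset.ne_of_mem_erase hv).symm, Finset.mul_sum]
      exact le_of_eq (Finset.sum_congr rfl fun c _ => by ring)
    calc _ = p w * ∑ c : W → X, (∏ u, P (c u)) * k (c w) *
          (∑ v ∈ Finset.univ.erase w, p v * k (c v)) ^ s := by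
            rw [Finset.mul_sum]
            exact Finset.sum_congr rfl fun c _ => by ring
      _ ≤ p w * (m ^ (1 - s) * ((∑ v, p v) * m ^ 2) ^ s) := by
            rw [sum_prod_mul_eq hP k w] at hJ
            gcongr
            exact hJ.trans (by gcongr)
      _ = p w * (∑ v, p v) ^ s * m ^ (1 + s) := by
            have : m ^ (1 + s) = m ^ (1 - s) * (m ^ 2) ^ s := by
              rw [← ENNReal.rpow_natCast, ← ENNReal.rpow_mul,
                ← ENNReal.rpow_add_of_nonneg _ _ (by linarith) (by positivity)]
              congr 1
              push_cast
              ring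
            rw [this, ENNReal.mul_rpow_of_nonneg _ _ hs0.le]
            ring
  calc _ ≤ ∑ c : W → X, ∑ w, ((∏ u, P (c u)) * (p w ^ (1 + s) * k (c w) ^ (1 + s)) +
          (∏ u, P (c u)) * (p w * k (c w) *
            (∑ v ∈ Finset.univ.erase w, p v * k (c v)) ^ s)) := by
        refine Finset.sum_le_sum fun c _ => ?_
        rw [← hpow, Finset.sum_mul, Finset.mul_sum]
        refine Finset.sum_le_sum fun w _ => ?_
        rw [← mul_add, ← ENNReal.mul_rpow_of_nonneg _ _ hs'.le, ← hpow, ← mul_add,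
          ← Finset.add_sum_erase _ _ (Finset.mem_univ w)]
        gcongr
        exact ENNReal.rpow_add_le_add_rpow _ _ hs0.le hs1
    _ = ∑ w, (p w ^ (1 + s) * (∑ c : W → X, (∏ u, P (c u)) * k (c w) ^ (1 + s)) +
          ∑ c : W → X, (∏ u, P (c u)) * (p w * k (c w) *
            (∑ v ∈ Finset.univ.erase w, p v * k (c v)) ^ s)) := by
        rw [Finset.sum_comm]
        refine Finset.sum_congr rfl fun w _ => ?_
        rw [Finset.sum_add_distrib, Finset.mul_sum]
        congr 1
        exact Finset.sum_congr rfl fun c _ => by ring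
    _ ≤ ∑ w, (p w ^ (1 + s) * (∑ x, P x * k x ^ (1 + s)) +
          p w * (∑ v, p v) ^ s * m ^ (1 + s)) := by
        refine Finset.sum_le_sum fun w _ => add_le_add (le_of_eq ?_) (hcross w)
        rw [sum_prod_mul_eq hP (fun x => k x ^ (1 + s)) w]
    _ = _ := by
        rw [Finset.sum_add_distrib, ← Finset.sum_mul, ← Finset.sum_mul, ← Finset.sum_mul, hpow]

lemma marg_fst_apply {A W : Type} [Fintype A] [Fintype W] (p : A × W → ℝ) (a : A) :
    marg Prod.fst p a = ∑ w, p (a, w) := by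
  simp only [marg, Fintype.sum_prod_type]
  rw [Finset.sum_eq_single a] <;> simp +contextual

/-- Summing `(∑ x, f x b y) * g a + μ a * h b y` over all indices when `μ` has total mass one. -/
lemma sum_add_mul_eq_of_sum_eq_one {A B X Y : Type} [Fintype A] [Fintype B] [Fintype X]
    [Fintype Y] {μ : A → ℝ≥0∞} (hμ : ∑ a, μ a = 1) (f : X → B → Y → ℝ≥0∞) (g : A → ℝ≥0∞)
    (h : B → Y → ℝ≥0∞) :
    ∑ y, ∑ a, ∑ b, ((∑ x, f x b y) * g a + μ a * h b y) =
      (∑ x, ∑ b, ∑ y, f x b y) * ∑ a, g a + ∑ b, ∑ y, h b y := by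
  simp only [Finset.sum_add_distrib, ← Finset.sum_mul, ← Finset.mul_sum, hμ, one_mul]
  rw [Finset.sum_comm (f := fun b y => h b y)]
  congr 2
  calc _ = ∑ b, ∑ y, ∑ x, f x b y := Finset.sum_comm
    _ = ∑ b, ∑ x, ∑ y, f x b y := Finset.sum_congr rfl fun _ _ => Finset.sum_comm
    _ = _ := Finset.sum_comm

/-- conditional one-shot channel resolvability: with
`C = {X(w)}_{w∈𝒲}` i.i.d. `∼ P_X` and `f_C(w) = X(w)`, for every `s ∈ (0,1]`,
joint `P_{AW}`, `P_B`, channel `P_{Y|XB}` and `Q_{Y|B}`,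
`exp(s·D_{1+s}(P_{Y|A,B,C}‖Q_{Y|B}|P_A P_B P_C)) ≤
  exp(s·D_{1+s}(P_{Y|XB}‖Q_{Y|B}|P_X P_B) - s·H_{1+s}(P_{W|A}|P_A))
  + exp(s·D_{1+s}(P_{Y|B}‖Q_{Y|B}|P_B))`, all sides in exponentiated form. -/
theorem one_shot_channel_resolvability_conditional
    (A W X B Y : Type) [Fintype A] [Fintype W] [Fintype X] [Fintype B] [Fintype Y]
    (PAW : A × W → ℝ) (hPAW : IsDist PAW) (PB : B → ℝ) (hPB : IsDist PB)
    (PX : X → ℝ) (hPX : IsDist PX)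
    (PYXB : X × B → Y → ℝ) (hPYXB : IsKernel PYXB)
    (QYB : B → Y → ℝ) (hQYB : IsKernel QYB)
    (s : ℝ) (hs0 : 0 < s) (hs1 : s ≤ 1) :
    rexp s
      (fun t : Y × A × B × (W → X) =>
        (∏ w, PX (t.2.2.2 w)) * PB t.2.2.1 *
          ∑ w, PAW (t.2.1, w) * PYXB (t.2.2.2 w, t.2.2.1) t.1)
      (fun t : Y × A × B × (W → X) =>
        marg Prod.fst PAW t.2.1 * PB t.2.2.1 * (∏ w, PX (t.2.2.2 w)) *
          QYB t.2.2.1 t.1) ≤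
    rexp s
        (fun p : X × B × Y => PX p.1 * PB p.2.1 * PYXB (p.1, p.2.1) p.2.2)
        (fun p : X × B × Y => PX p.1 * PB p.2.1 * QYB p.2.1 p.2.2) *
      rexp s PAW (fun p : A × W => marg Prod.fst PAW p.1) +
    rexp s
      (fun p : B × Y => PB p.1 * ∑ x, PX x * PYXB (x, p.1) p.2)
      (fun p : B × Y => PB p.1 * QYB p.1 p.2) := by
  obtain ⟨hAW0, hAW1⟩ := hPAW
  obtain ⟨hB0, -⟩ := hPB
  obtain ⟨hX0, hX1⟩ := hPX
  have hmarg : ∀ a, ENNReal.ofReal (marg Prod.fst PAW a) =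
      ∑ w, ENNReal.ofReal (PAW (a, w)) := fun a => by
    rw [marg_fst_apply, ENNReal.ofReal_sum_of_nonneg fun w _ => hAW0 _]
  have hmarg0 : ∀ a, 0 ≤ marg Prod.fst PAW a := fun a => by
    rw [marg_fst_apply]
    exact Finset.sum_nonneg fun w _ => hAW0 _
  have hX1' : ∑ x, ENNReal.ofReal (PX x) = 1 := by
    rw [← ENNReal.ofReal_sum_of_nonneg fun x _ => hX0 x, hX1, ENNReal.ofReal_one]
  have hA1 : ∑ a, ENNReal.ofReal (marg Prod.fst PAW a) = 1 := by
    simp only [hmarg]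
    rw [← Fintype.sum_prod_type (fun p : A × W => ENNReal.ofReal (PAW p)),
      ← ENNReal.ofReal_sum_of_nonneg fun p _ => hAW0 p, hAW1, ENNReal.ofReal_one]
  set K : X → B → Y → ℝ≥0∞ := fun x b y => ENNReal.ofReal (PYXB (x, b) y)
  set Q : B → Y → ℝ≥0∞ := fun b y => ENNReal.ofReal (QYB b y)
  set β : B → ℝ≥0∞ := fun b => ENNReal.ofReal (PB b)
  set π : X → ℝ≥0∞ := fun x => ENNReal.ofReal (PX x)
  set μ : A → ℝ≥0∞ := fun a => ENNReal.ofReal (marg Prod.fst PAW a)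
  set ρ : A → W → ℝ≥0∞ := fun a w => ENNReal.ofReal (PAW (a, w))
  have hL : ∀ (y : Y) (a : A) (b : B) (c : W → X),
      ENNReal.ofReal ((∏ w, PX (c w)) * PB b * ∑ w, PAW (a, w) * PYXB (c w, b) y) ^ (1 + s) *
        ENNReal.ofReal (marg Prod.fst PAW a * PB b * (∏ w, PX (c w)) * QYB b y) ^ (-s) =
      β b * Q b y ^ (-s) * μ a ^ (-s) *
        ((∏ w, π (c w)) * (∑ w, ρ a w * K (c w) b y) ^ (1 + s)) := by
    intro y a b c
    have hc0 : 0 ≤ ∏ w, PX (c w) := Finset.prod_nonneg fun w _ => hX0 _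
    have hcb := mul_nonneg hc0 (hB0 b)
    have hS : ENNReal.ofReal (∑ w, PAW (a, w) * PYXB (c w, b) y) =
        ∑ w, ρ a w * K (c w) b y := by
      rw [ENNReal.ofReal_sum_of_nonneg fun w _ => mul_nonneg (hAW0 _) ((hPYXB _).1 _)]
      exact Finset.sum_congr rfl fun w _ => ENNReal.ofReal_mul (hAW0 _)
    rw [show marg Prod.fst PAW a * PB b * (∏ w, PX (c w)) * QYB b y =
        (∏ w, PX (c w)) * PB b * (marg Prod.fst PAW a * QYB b y) by ring,
      ENNReal.ofReal_mul hcb, ENNReal.ofReal_mul hcb,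
      ENNReal.mul_rpow_mul_mul_rpow_neg hs0 ENNReal.ofReal_ne_top ENNReal.ofReal_ne_top,
      ENNReal.ofReal_mul (hmarg0 a),
      ENNReal.mul_rpow_of_ne_top ENNReal.ofReal_ne_top ENNReal.ofReal_ne_top,
      ENNReal.ofReal_mul hc0, ENNReal.ofReal_prod_of_nonneg fun w _ => hX0 _, hS]
    ring
  have hR₁ : ∀ (x : X) (b : B) (y : Y),
      ENNReal.ofReal (PX x * PB b * PYXB (x, b) y) ^ (1 + s) *
        ENNReal.ofReal (PX x * PB b * QYB b y) ^ (-s) =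
      β b * Q b y ^ (-s) * (π x * K x b y ^ (1 + s)) := by
    intro x b y
    have h := mul_nonneg (hX0 x) (hB0 b)
    rw [ENNReal.ofReal_mul h, ENNReal.ofReal_mul h,
      ENNReal.mul_rpow_mul_mul_rpow_neg hs0 ENNReal.ofReal_ne_top ENNReal.ofReal_ne_top,
      ENNReal.ofReal_mul (hX0 x)]
    ring
  have hR₂ : ∀ (b : B) (y : Y),
      ENNReal.ofReal (PB b * ∑ x, PX x * PYXB (x, b) y) ^ (1 + s) *
        ENNReal.ofReal (PB b * QYB b y) ^ (-s) =
      β b * Q b y ^ (-s) * (∑ x, π x * K x b y) ^ (1 + s) := by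
    intro b y
    have hS : ENNReal.ofReal (∑ x, PX x * PYXB (x, b) y) = ∑ x, π x * K x b y := by
      rw [ENNReal.ofReal_sum_of_nonneg fun x _ => mul_nonneg (hX0 x) ((hPYXB _).1 _)]
      exact Finset.sum_congr rfl fun x _ => ENNReal.ofReal_mul (hX0 x)
    rw [ENNReal.ofReal_mul (hB0 b), ENNReal.ofReal_mul (hB0 b),
      ENNReal.mul_rpow_mul_mul_rpow_neg hs0 ENNReal.ofReal_ne_top ENNReal.ofReal_ne_top, hS]
    ring
  have hμ_pow : ∀ a, μ a ^ (-s) * μ a ^ (1 + s) = μ a := fun a => by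
    simpa [mul_comm] using ENNReal.mul_rpow_mul_mul_rpow_neg hs0
      (ENNReal.ofReal_ne_top (r := marg Prod.fst PAW a)) ENNReal.one_ne_top 1
  have hcore : ∀ (y : Y) (a : A) (b : B),
      ∑ c : W → X, β b * Q b y ^ (-s) * μ a ^ (-s) *
        ((∏ w, π (c w)) * (∑ w, ρ a w * K (c w) b y) ^ (1 + s)) ≤
      (∑ x, β b * Q b y ^ (-s) * (π x * K x b y ^ (1 + s))) *
          (∑ w, ρ a w ^ (1 + s) * μ a ^ (-s)) +
        μ a * (β b * Q b y ^ (-s) * (∑ x, π x * K x b y) ^ (1 + s)) := by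
    intro y a b
    rw [← Finset.mul_sum, ← Finset.mul_sum, ← Finset.sum_mul]
    have h := sum_prod_mul_rpow_le hs0 hs1 (P := π) hX1' (fun x => K x b y) (ρ a)
    rw [show ∑ w, ρ a w = μ a from (hmarg a).symm] at h
    refine (mul_le_mul_right h _).trans (le_of_eq ?_)
    calc _ = _ := mul_add _ _ _
      _ = (β b * Q b y ^ (-s) * ∑ x, π x * K x b y ^ (1 + s)) *
            ((∑ w, ρ a w ^ (1 + s)) * μ a ^ (-s)) + μ a ^ (-s) * μ a ^ (1 + s) *
              (β b * Q b y ^ (-s) * (∑ x, π x * K x b y) ^ (1 + s)) := by ring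
      _ = _ := by rw [hμ_pow]
  simp only [rexp, Fintype.sum_prod_type, hL, hR₁, hR₂]
  refine (Finset.sum_le_sum fun y _ => Finset.sum_le_sum fun a _ =>
    Finset.sum_le_sum fun b _ => hcore y a b).trans (le_of_eq ?_)
  exact sum_add_mul_eq_of_sum_eq_one hA1
    (fun x b y => β b * Q b y ^ (-s) * (π x * K x b y ^ (1 + s)))
    (fun a => ∑ w, ρ a w ^ (1 + s) * μ a ^ (-s))
    (fun b y => β b * Q b y ^ (-s) * (∑ x, π x * K x b y) ^ (1 + s))

end
end

section
/- One-shot resolvability for superposition codes: Let 𝒲, 𝒲̂, 𝒳, 𝒳̂, 𝒴 be finite sets and P_{XX̂} a distribution on 𝒳×𝒳̂. Let C = {(X(w), X̂(w,ŵ))} be a random superposition codebook: the X(w), w ∈ 𝒲, are drawn i.i.d. from P_X, and given w, the X̂(w,ŵ), ŵ ∈ 𝒲̂, are drawn independently from P_{X̂|X}(·|X(w)); set f_C(w,ŵ) = (X(w), X̂(w,ŵ)). Then for every s ∈ (0,1], every distribution P_{WŴ} on 𝒲×𝒲̂, every channel P_{Y|XX̂}, and every distribution Q_Y on 𝒴: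 exp(s · D_{1+s}(P_{Y|C} ‖ Q_Y | P_C)) ≤ exp(s · D_{1+s}(P_{Y|XX̂} ‖ Q_Y | P_{XX̂}) − s · H_{1+s}(P_{WŴ})) + exp(s · D_{1+s}(P_{Y|X} ‖ Q_Y | P_X) − s · H_{1+s}(P_W)) + exp(s · D_{1+s}(P_Y ‖ Q_Y)), where P_{Y|C} is induced by the true joint distribution P_C P_{WŴ} P_{Y|(X,X̂)=f_C(W,Ŵ)}, and P_Y, P_{Y|X} are induced by the ideal joint distribution P_{XX̂} P_{Y|XX̂}. -/
open scoped BigOperators ENNReal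
open Classical

noncomputable section

/-- Hölder's inequality in the form of Jensen's inequality for `t ↦ t ^ s` with unnormalised
weights. -/
theorem sum_mul_rpow_le_rpow_mul_rpow {ι : Type} [Fintype ι] {s : ℝ} (hs0 : 0 < s) (hs1 : s ≤ 1)
    (w f : ι → ℝ≥0∞) :
    ∑ i, w i * f i ^ s ≤ (∑ i, w i) ^ (1 - s) * (∑ i, w i * f i) ^ s := by
  have h := ENNReal.inner_le_weight_mul_Lp_of_nonneg Finset.univ
    (one_le_inv_iff₀.mpr ⟨hs0, hs1⟩) w (fun i => f i ^ s)
  simpa only [inv_inv, ENNReal.rpow_rpow_inv hs0.ne'] using h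

theorem rpow_one_add_eq {s : ℝ} (hs0 : 0 < s) (x : ℝ≥0∞) : x ^ (1 + s) = x * x ^ s := by
  rw [ENNReal.rpow_add_of_nonneg _ _ zero_le_one hs0.le, ENNReal.rpow_one]

/-- Expectation of a function of a single coordinate under a product distribution. -/
theorem sum_prod_mul_apply {ι α : Type} [Fintype ι] [DecidableEq ι] [Fintype α]
    (κ : ι → α → ℝ≥0∞)
    (hκ : ∀ i, ∑ a, κ i a = 1) (i : ι) (u : α → ℝ≥0∞) :
    ∑ c : ι → α, (∏ j, κ j (c j)) * u (c i) = ∑ a, κ i a * u a := by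
  have h := Fintype.prod_sum (fun j a => κ j a * if j = i then u a else 1)
  simp only [Finset.prod_mul_distrib, Finset.prod_ite_eq', Finset.mem_univ, if_true] at h
  rw [← h, Finset.prod_eq_single i]
  · simp
  · intro j _ hj
    simp [hj, hκ]
  · simp

/-- Expectation of a product of functions of two distinct coordinates under a product
distribution. -/
theorem sum_prod_mul_apply_mul_apply {ι α : Type} [Fintype ι] [DecidableEq ι] [Fintype α]
    (κ : ι → α → ℝ≥0∞)
    (hκ : ∀ i, ∑ a, κ i a = 1) {i j : ι} (hij : i ≠ j) (u v : α → ℝ≥0∞) :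
    ∑ c : ι → α, (∏ l, κ l (c l)) * (u (c i) * v (c j)) =
      (∑ a, κ i a * u a) * ∑ a, κ j a * v a := by
  have h := Fintype.prod_sum
    (fun l a => κ l a * ((if l = i then u a else 1) * if l = j then v a else 1))
  simp only [Finset.prod_mul_distrib, Finset.prod_ite_eq', Finset.mem_univ, if_true] at h
  rw [← h, Finset.prod_eq_mul i j hij]
  · simp [hij, hij.symm]
  · rintro l _ ⟨hl, hl'⟩
    simp [hl, hl', hκ]
  · simp
  · simp

theorem sum_prod_mul_apply_mul_sum_rpow_le {ι α : Type} [Fintype ι] [DecidableEq ι] [Fintype α]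
    (κ : ι → α → ℝ≥0∞) (hκ : ∀ i, ∑ a, κ i a = 1) {s : ℝ} (hs0 : 0 < s) (hs1 : s ≤ 1)
    (b : ι → α → ℝ≥0∞) (i : ι) :
    ∑ c : ι → α, (∏ l, κ l (c l)) * (b i (c i) * (∑ j ∈ Finset.univ.erase i, b j (c j)) ^ s) ≤
      (∑ a, κ i a * b i a) * (∑ j, ∑ a, κ j a * b j a) ^ s := by
  have h1 := sum_mul_rpow_le_rpow_mul_rpow hs0 hs1
    (fun c : ι → α => (∏ l, κ l (c l)) * b i (c i))
    (fun c => ∑ j ∈ Finset.univ.erase i, b j (c j))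
  have h2 : ∑ c : ι → α, ((∏ l, κ l (c l)) * b i (c i)) *
      ∑ j ∈ Finset.univ.erase i, b j (c j) ≤
      (∑ a, κ i a * b i a) * ∑ j, ∑ a, κ j a * b j a := by
    simp only [mul_assoc, Finset.mul_sum (s := Finset.univ.erase i)]
    rw [Finset.sum_comm]
    calc _ = ∑ j ∈ Finset.univ.erase i, (∑ a, κ i a * b i a) * ∑ a, κ j a * b j a :=
          Finset.sum_congr rfl fun j hj =>
            sum_prod_mul_apply_mul_apply κ hκ (Finset.ne_of_mem_erase hj).symm _ _
      _ ≤ ∑ j, (∑ a, κ i a * b i a) * ∑ a, κ j a * b j a :=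
          Finset.sum_le_sum_of_subset (Finset.erase_subset _ _)
      _ = _ := by rw [Finset.mul_sum]
  rw [sum_prod_mul_apply κ hκ] at h1
  simp only [mul_assoc] at h1 h2
  refine h1.trans ((mul_le_mul_right (ENNReal.rpow_le_rpow h2 hs0.le) _).trans_eq ?_)
  rw [ENNReal.mul_rpow_of_nonneg _ _ hs0.le, ← mul_assoc,
    ← ENNReal.rpow_add_of_nonneg _ _ (sub_nonneg.mpr hs1) hs0.le]
  simp

/-- Moment bound of order `1 + s` for a sum of independent nonnegative variables. -/
theorem sum_prod_mul_sum_rpow_le {ι α : Type} [Fintype ι] [DecidableEq ι] [Fintype α]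
    (κ : ι → α → ℝ≥0∞) (hκ : ∀ i, ∑ a, κ i a = 1) {s : ℝ} (hs0 : 0 < s) (hs1 : s ≤ 1)
    (b : ι → α → ℝ≥0∞) :
    ∑ c : ι → α, (∏ l, κ l (c l)) * (∑ i, b i (c i)) ^ (1 + s) ≤
      (∑ i, ∑ a, κ i a * b i a ^ (1 + s)) + (∑ i, ∑ a, κ i a * b i a) ^ (1 + s) := by
  have hpt (c : ι → α) : (∑ i, b i (c i)) ^ (1 + s) ≤
      ∑ i, (b i (c i) ^ (1 + s) +
        b i (c i) * (∑ j ∈ Finset.univ.erase i, b j (c j)) ^ s) := by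
    rw [rpow_one_add_eq hs0, Finset.sum_mul]
    refine Finset.sum_le_sum fun i _ => ?_
    rw [rpow_one_add_eq hs0, ← mul_add,
      ← Finset.add_sum_erase Finset.univ (fun j => b j (c j)) (Finset.mem_univ i)]
    exact mul_le_mul_right (ENNReal.rpow_add_le_add_rpow _ _ hs0.le hs1) _
  calc _ ≤ ∑ c : ι → α, (∏ l, κ l (c l)) * ∑ i, (b i (c i) ^ (1 + s) +
        b i (c i) * (∑ j ∈ Finset.univ.erase i, b j (c j)) ^ s) :=
        Finset.sum_le_sum fun c _ => mul_le_mul_right (hpt c) _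
    _ = ∑ i, (∑ c : ι → α, (∏ l, κ l (c l)) * b i (c i) ^ (1 + s) +
        ∑ c : ι → α, (∏ l, κ l (c l)) *
          (b i (c i) * (∑ j ∈ Finset.univ.erase i, b j (c j)) ^ s)) := by
        simp only [Finset.mul_sum (s := (Finset.univ : Finset ι)), mul_add]
        rw [Finset.sum_comm]
        simp only [Finset.sum_add_distrib]
    _ ≤ ∑ i, (∑ a, κ i a * b i a ^ (1 + s) +
        (∑ a, κ i a * b i a) * (∑ j, ∑ a, κ j a * b j a) ^ s) := by
        refine Finset.sum_le_sum fun i _ => add_le_add ?_ ?_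
        · exact (sum_prod_mul_apply κ hκ i (fun a => b i a ^ (1 + s))).le
        · exact sum_prod_mul_apply_mul_sum_rpow_le κ hκ hs0 hs1 b i
    _ = _ := by rw [Finset.sum_add_distrib, ← Finset.sum_mul, ← rpow_one_add_eq hs0]

/-- Moment bound of order `1 + s` for a superposition codebook, at a fixed channel output. -/
theorem superposition_moment_le {W Wh X Xh : Type} [Fintype W] [Fintype Wh] [Fintype X]
    [Fintype Xh] (p : W × Wh → ℝ≥0∞) (hp : ∑ i, p i = 1) (μ : X → ℝ≥0∞) (hμ : ∑ x, μ x = 1)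
    (k : X → Xh → ℝ≥0∞) (hk : ∀ x, ∑ z, k x z = 1) (v : X → Xh → ℝ≥0∞)
    {s : ℝ} (hs0 : 0 < s) (hs1 : s ≤ 1) :
    ∑ c : (W → X) × (W × Wh → Xh), ((∏ w, μ (c.1 w)) * ∏ i : W × Wh, k (c.1 i.1) (c.2 i)) *
        (∑ i : W × Wh, p i * v (c.1 i.1) (c.2 i)) ^ (1 + s) ≤
      (∑ x, ∑ z, μ x * k x z * v x z ^ (1 + s)) * ∑ i, p i ^ (1 + s) +
      (∑ x, μ x * (∑ z, k x z * v x z) ^ (1 + s)) * ∑ w, (∑ z, p (w, z)) ^ (1 + s) +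
      (∑ x, ∑ z, μ x * k x z * v x z) ^ (1 + s) := by
  have h1s : 0 ≤ 1 + s := by linarith
  have inner (f : W → X) : ∑ c : W × Wh → Xh, (∏ i : W × Wh, k (f i.1) (c i)) *
      (∑ i : W × Wh, p i * v (f i.1) (c i)) ^ (1 + s) ≤
      (∑ i : W × Wh, p i ^ (1 + s) * ∑ z, k (f i.1) z * v (f i.1) z ^ (1 + s)) +
      (∑ w, (∑ z, p (w, z)) * ∑ z, k (f w) z * v (f w) z) ^ (1 + s) := by
    refine (sum_prod_mul_sum_rpow_le (fun i : W × Wh => k (f i.1)) (fun i => hk _) hs0 hs1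
      (fun i z => p i * v (f i.1) z)).trans_eq ?_
    simp only [ENNReal.mul_rpow_of_nonneg _ _ h1s, mul_left_comm _ (p _),
      mul_left_comm _ (p _ ^ (1 + s)), ← Finset.mul_sum]
    congr 2
    rw [Fintype.sum_prod_type]
    simp only [Finset.sum_mul]
  have outer := sum_prod_mul_sum_rpow_le (fun _ : W => μ) (fun _ => hμ) hs0 hs1
    (fun w x => (∑ z, p (w, z)) * ∑ z, k x z * v x z)
  rw [Fintype.sum_prod_type]
  calc _ = ∑ f : W → X, (∏ w, μ (f w)) * ∑ c : W × Wh → Xh,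
        (∏ i : W × Wh, k (f i.1) (c i)) *
          (∑ i : W × Wh, p i * v (f i.1) (c i)) ^ (1 + s) := by
        simp only [Finset.mul_sum (s := (Finset.univ : Finset (W × Wh → Xh))), mul_assoc]
    _ ≤ ∑ f : W → X, (∏ w, μ (f w)) *
        ((∑ i : W × Wh, p i ^ (1 + s) * ∑ z, k (f i.1) z * v (f i.1) z ^ (1 + s)) +
          (∑ w, (∑ z, p (w, z)) * ∑ z, k (f w) z * v (f w) z) ^ (1 + s)) :=
        Finset.sum_le_sum fun f _ => mul_le_mul_right (inner f) _
    _ = (∑ i : W × Wh, ∑ f : W → X, (∏ w, μ (f w)) *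
          (p i ^ (1 + s) * ∑ z, k (f i.1) z * v (f i.1) z ^ (1 + s))) +
        ∑ f : W → X, (∏ w, μ (f w)) *
          (∑ w, (∑ z, p (w, z)) * ∑ z, k (f w) z * v (f w) z) ^ (1 + s) := by
        simp only [mul_add, Finset.sum_add_distrib]
        rw [Finset.sum_comm]
        simp only [Finset.mul_sum (s := (Finset.univ : Finset (W × Wh)))]
    _ ≤ _ := by
        rw [add_assoc]
        refine add_le_add (le_of_eq ?_) (outer.trans_eq ?_)
        · rw [Finset.mul_sum]
          refine Finset.sum_congr rfl fun i _ => ?_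
          rw [sum_prod_mul_apply (fun _ : W => μ) (fun _ => hμ) i.1
            (fun x => p i ^ (1 + s) * ∑ z, k x z * v x z ^ (1 + s))]
          simp only [mul_left_comm _ (p _ ^ (1 + s)), ← Finset.mul_sum, mul_assoc]
          rw [mul_comm]
        · have hp' : ∑ w, ∑ z, p (w, z) = 1 := by rw [← hp, Fintype.sum_prod_type]
          have hm : ∑ x, ∑ z, μ x * k x z * v x z = ∑ x, μ x * ∑ z, k x z * v x z := by
            simp only [Finset.mul_sum, mul_assoc]
          rw [hm]
          simp only [ENNReal.mul_rpow_of_nonneg _ _ h1s, mul_left_comm (μ _),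
            ← Finset.mul_sum, ← Finset.sum_mul, hp', one_mul]
          rw [mul_comm]

theorem ofReal_mul_rpow_mul_ofReal_mul_rpow {a : ℝ} (ha : 0 ≤ a) (b c : ℝ) {s : ℝ}
    (hs0 : 0 < s) :
    ENNReal.ofReal (a * b) ^ (1 + s) * ENNReal.ofReal (a * c) ^ (-s) =
      ENNReal.ofReal a * (ENNReal.ofReal b ^ (1 + s) * ENNReal.ofReal c ^ (-s)) := by
  have h1s : 0 < 1 + s := by linarith
  rcases ha.eq_or_lt with rfl | ha'
  · simp [h1s]
  · have h0 : ENNReal.ofReal a ≠ 0 := by simpa using ha'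
    rw [ENNReal.ofReal_mul ha, ENNReal.ofReal_mul ha,
      ENNReal.mul_rpow_of_ne_top ENNReal.ofReal_ne_top ENNReal.ofReal_ne_top,
      ENNReal.mul_rpow_of_ne_top ENNReal.ofReal_ne_top ENNReal.ofReal_ne_top, mul_mul_mul_comm,
      ← ENNReal.rpow_add _ _ h0 ENNReal.ofReal_ne_top]
    simp

theorem sum_ofReal_eq_one {α : Type} [Fintype α] {p : α → ℝ} (hp : IsDist p) :
    ∑ a, ENNReal.ofReal (p a) = 1 := by
  rw [← ENNReal.ofReal_sum_of_nonneg fun a _ => hp.1 a, hp.2, ENNReal.ofReal_one]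

theorem rexp_const_one {α : Type} [Fintype α] (s : ℝ) (p : α → ℝ) :
    rexp s p (fun _ => (1 : ℝ)) = ∑ a, ENNReal.ofReal (p a) ^ (1 + s) := by
  simp [rexp]

/-- A common nonnegative factor of the two arguments acts as a weight. -/
theorem rexp_mul_left {α β : Type} [Fintype α] [Fintype β] {s : ℝ} (hs0 : 0 < s)
    (e : α → β) {m : β → ℝ} (hm : ∀ b, 0 ≤ m b) (p q : α → ℝ) :
    rexp s (fun a => m (e a) * p a) (fun a => m (e a) * q a) =
      ∑ a, ENNReal.ofReal (m (e a)) *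
        (ENNReal.ofReal (p a) ^ (1 + s) * ENNReal.ofReal (q a) ^ (-s)) :=
  Finset.sum_congr rfl fun _ _ => ofReal_mul_rpow_mul_ofReal_mul_rpow (hm _) _ _ hs0

theorem marg_fst {α β : Type} [Fintype α] [Fintype β] (p : α × β → ℝ) (a : α) :
    marg Prod.fst p a = ∑ b, p (a, b) := by
  rw [marg, Fintype.sum_prod_type, Finset.sum_comm]
  simp

/-- one-shot resolvability for superposition codes: the codebook is
`C = {(X(w), X̂(w,ŵ))}` with `X(w)` i.i.d. `∼ P_X` and, given `w`, `X̂(w,ŵ)` drawn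
independently `∼ P_{X̂|X}(·|X(w))`; `P_{XX̂} = P_X P_{X̂|X}`.  For every `s ∈ (0,1]`,
`P_{WŴ}`, channel `P_{Y|XX̂}` and `Q_Y`,
`exp(s·D_{1+s}(P_{Y|C}‖Q_Y|P_C)) ≤
   exp(s·D_{1+s}(P_{Y|XX̂}‖Q_Y|P_{XX̂}) - s·H_{1+s}(P_{WŴ}))
 + exp(s·D_{1+s}(P_{Y|X}‖Q_Y|P_X) - s·H_{1+s}(P_W))
 + exp(s·D_{1+s}(P_Y‖Q_Y))`, all sides in exponentiated form. -/
theorem one_shot_superposition_resolvability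
    (W Wh X Xh Y : Type) [Fintype W] [Fintype Wh] [Fintype X] [Fintype Xh] [Fintype Y]
    (PWW : W × Wh → ℝ) (hPWW : IsDist PWW)
    (PX : X → ℝ) (hPX : IsDist PX)
    (K : X → Xh → ℝ) (hK : IsKernel K)
    (PYXX : X × Xh → Y → ℝ) (hPYXX : IsKernel PYXX)
    (QY : Y → ℝ) (hQY : IsDist QY)
    (s : ℝ) (hs0 : 0 < s) (hs1 : s ≤ 1) :
    rexp s
      (fun t : Y × ((W → X) × (W × Wh → Xh)) =>
        ((∏ w, PX (t.2.1 w)) * ∏ p : W × Wh, K (t.2.1 p.1) (t.2.2 p)) *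
          ∑ p : W × Wh, PWW p * PYXX (t.2.1 p.1, t.2.2 p) t.1)
      (fun t : Y × ((W → X) × (W × Wh → Xh)) =>
        ((∏ w, PX (t.2.1 w)) * ∏ p : W × Wh, K (t.2.1 p.1) (t.2.2 p)) * QY t.1) ≤
    rexp s
        (fun r : X × Xh × Y => PX r.1 * K r.1 r.2.1 * PYXX (r.1, r.2.1) r.2.2)
        (fun r : X × Xh × Y => PX r.1 * K r.1 r.2.1 * QY r.2.2) *
      rexp s PWW (fun _ : W × Wh => (1 : ℝ)) +
    rexp s
        (fun r : X × Y => PX r.1 * ∑ xh, K r.1 xh * PYXX (r.1, xh) r.2)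
        (fun r : X × Y => PX r.1 * QY r.2) *
      rexp s (marg Prod.fst PWW) (fun _ : W => (1 : ℝ)) +
    rexp s (fun y : Y => ∑ x, ∑ xh, PX x * K x xh * PYXX (x, xh) y) QY := by
  have hm1 (c : (W → X) × (W × Wh → Xh)) : 0 ≤ ∏ w, PX (c.1 w) :=
    Finset.prod_nonneg fun w _ => hPX.1 _
  have hm2 (c : (W → X) × (W × Wh → Xh)) : 0 ≤ ∏ i : W × Wh, K (c.1 i.1) (c.2 i) :=
    Finset.prod_nonneg fun i _ => (hK _).1 _
  have hXK (r : X × Xh) : 0 ≤ PX r.1 * K r.1 r.2 := mul_nonneg (hPX.1 _) ((hK _).1 _)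
  rw [rexp_mul_left hs0 Prod.snd (m := fun c : (W → X) × (W × Wh → Xh) =>
      (∏ w, PX (c.1 w)) * ∏ i : W × Wh, K (c.1 i.1) (c.2 i))
      (fun c => mul_nonneg (hm1 c) (hm2 c))
      (fun t => ∑ i : W × Wh, PWW i * PYXX (t.2.1 i.1, t.2.2 i) t.1) (fun t => QY t.1),
    rexp_mul_left hs0 (fun r : X × Xh × Y => (r.1, r.2.1))
      (m := fun r : X × Xh => PX r.1 * K r.1 r.2) hXK
      (fun r => PYXX (r.1, r.2.1) r.2.2) (fun r => QY r.2.2),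
    rexp_mul_left hs0 (Prod.fst : X × Y → X) (m := PX) hPX.1
      (fun r => ∑ xh, K r.1 xh * PYXX (r.1, xh) r.2) (fun r => QY r.2),
    rexp_const_one, rexp_const_one]
  simp only [rexp, marg_fst]
  have key (y : Y) := mul_le_mul_left (superposition_moment_le (W := W) (Wh := Wh)
    (fun i => ENNReal.ofReal (PWW i)) (sum_ofReal_eq_one hPWW)
    (fun x => ENNReal.ofReal (PX x)) (sum_ofReal_eq_one hPX)
    (fun x z => ENNReal.ofReal (K x z)) (fun x => sum_ofReal_eq_one (hK x))
    (fun x z => ENNReal.ofReal (PYXX (x, z) y)) hs0 hs1) (ENNReal.ofReal (QY y) ^ (-s))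
  have sumXh (x : X) (y : Y) : ENNReal.ofReal (∑ z, K x z * PYXX (x, z) y) =
      ∑ z, ENNReal.ofReal (K x z) * ENNReal.ofReal (PYXX (x, z) y) := by
    rw [ENNReal.ofReal_sum_of_nonneg fun z _ => mul_nonneg ((hK x).1 z) ((hPYXX _).1 y)]
    exact Finset.sum_congr rfl fun z _ => ENNReal.ofReal_mul ((hK x).1 z)
  have sumAll (y : Y) : ENNReal.ofReal (∑ x, ∑ z, PX x * K x z * PYXX (x, z) y) =
      ∑ x, ∑ z, ENNReal.ofReal (PX x) * ENNReal.ofReal (K x z) *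
        ENNReal.ofReal (PYXX (x, z) y) := by
    rw [ENNReal.ofReal_sum_of_nonneg fun x _ => Finset.sum_nonneg fun z _ =>
      mul_nonneg (hXK (x, z)) ((hPYXX _).1 y)]
    refine Finset.sum_congr rfl fun x _ => ?_
    rw [ENNReal.ofReal_sum_of_nonneg fun z _ => mul_nonneg (hXK (x, z)) ((hPYXX _).1 y)]
    refine Finset.sum_congr rfl fun z _ => ?_
    rw [ENNReal.ofReal_mul (hXK (x, z)), ENNReal.ofReal_mul (hPX.1 x)]
  have sumW (w : W) : ENNReal.ofReal (∑ z, PWW (w, z)) = ∑ z, ENNReal.ofReal (PWW (w, z)) :=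
    ENNReal.ofReal_sum_of_nonneg fun z _ => hPWW.1 _
  have sumWW (c : (W → X) × (W × Wh → Xh)) (y : Y) :
      ENNReal.ofReal (∑ i : W × Wh, PWW i * PYXX (c.1 i.1, c.2 i) y) =
      ∑ i : W × Wh, ENNReal.ofReal (PWW i) * ENNReal.ofReal (PYXX (c.1 i.1, c.2 i) y) := by
    rw [ENNReal.ofReal_sum_of_nonneg fun i _ => mul_nonneg (hPWW.1 i) ((hPYXX _).1 y)]
    exact Finset.sum_congr rfl fun i _ => ENNReal.ofReal_mul (hPWW.1 i)
  have weight (c : (W → X) × (W × Wh → Xh)) :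
      ENNReal.ofReal ((∏ w, PX (c.1 w)) * ∏ i : W × Wh, K (c.1 i.1) (c.2 i)) =
      (∏ w, ENNReal.ofReal (PX (c.1 w))) *
        ∏ i : W × Wh, ENNReal.ofReal (K (c.1 i.1) (c.2 i)) := by
    rw [ENNReal.ofReal_mul (hm1 c), ENNReal.ofReal_prod_of_nonneg fun w _ => hPX.1 _,
      ENNReal.ofReal_prod_of_nonneg fun i _ => (hK _).1 _]
  simp only [sumXh, sumAll, sumW, sumWW, weight, ENNReal.ofReal_mul (hPX.1 _)]
  calc _ = _ := by
        rw [Fintype.sum_prod_type]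
        simp only [← mul_assoc, ← Finset.sum_mul]
        rfl
    _ ≤ _ := Finset.sum_le_sum fun y _ => key y
    _ = _ := by
        simp only [add_mul, Finset.sum_add_distrib]
        congr 2
        · simp only [mul_right_comm _ (∑ i, ENNReal.ofReal (PWW i) ^ (1 + s)),
            ← Finset.sum_mul]
          congr 1
          simp only [Fintype.sum_prod_type, Finset.sum_mul, mul_assoc]
          rw [Finset.sum_comm]
          exact Finset.sum_congr rfl fun x _ => Finset.sum_comm
        · simp only [mul_right_comm _
            (∑ w, (∑ z, ENNReal.ofReal (PWW (w, z))) ^ (1 + s)), ← Finset.sum_mul]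
          congr 1
          simp only [Fintype.sum_prod_type, Finset.sum_mul, mul_assoc]
          rw [Finset.sum_comm]

end
end
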